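/- Fix a positive integer p. The expected value of the height of a uniformly random p-watermelon of length 2n satisfies E(H_{n,p}) = ( ∫_0^∞ κ_p(h) dh ) · √n + p − 3/2 + O(n^{−1/2}) as n → ∞, where κ_p(h) = 1 − (2^{−C(p,2)}/Π_{j=0}^{p−1} j!) det_{0≤i,j<p}( (−1)^i H_{i+j}(0) − H_{i+j}(h) e^{−h²} ). -/

import Mathlib

open scoped BigOperators
open Filter MeasureTheory

/-- Binomial coefficient with integer lower argument, `0` outside range. -/
def ichoose (a : ℕ) (b : ℤ) : ℕ := if 0 ≤ b then a.choose b.toNat else 0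

/-- A `p`-watermelon of length `2n` (no wall): the `i`-th branch starts at `(0,2i)`,
ends at `(2n,2i)`, takes steps `(1,1)` or `(1,-1)`, and no two branches share a point.
`y i t` is the ordinate of the `i`-th branch at abscissa `t`. -/
def IsMelon (p n : ℕ) (y : Fin p → Fin (2*n+1) → ℤ) : Prop :=
  (∀ i, y i 0 = 2 * (i : ℤ)) ∧
  (∀ i, y i (Fin.last (2*n)) = 2 * (i : ℤ)) ∧
  (∀ i (t : Fin (2*n)), y i t.succ - y i t.castSucc = 1 ∨ y i t.succ - y i t.castSucc = -1) ∧
  (∀ i j, i ≠ j → ∀ t, y i t ≠ y j t)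

/-- The height of a watermelon: the maximal ordinate reached (by its top-most branch). -/
noncomputable def melonHeight {p n : ℕ} (y : Fin p → Fin (2*n+1) → ℤ) : ℤ :=
  sSup {v | ∃ i t, y i t = v}

/-- The depth of a watermelon: the minimal ordinate reached (by its bottom-most branch). -/
noncomputable def melonDepth {p n : ℕ} (y : Fin p → Fin (2*n+1) → ℤ) : ℤ :=
  sInf {v | ∃ i t, y i t = v}

/-- The range of a watermelon: height minus depth. -/
noncomputable def melonRange {p n : ℕ} (y : Fin p → Fin (2*n+1) → ℤ) : ℤ :=
  melonHeight y - melonDepth y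

/-- The `k`-th physicists' Hermite polynomial, via
`H_k(z)/k! = Σ_m ((-1)^(k-m)/(k-m)!) (2z)^(2m-k)/(2m-k)!` (terms with negative
factorial arguments being zero). -/
noncomputable def hermiteH (k : ℕ) (z : ℝ) : ℝ :=
  (k.factorial : ℝ) * ∑ m ∈ Finset.range (k+1),
    if k ≤ 2*m then ((-1:ℝ)^(k-m) / (k-m).factorial) * ((2*z)^(2*m-k) / (2*m-k).factorial)
    else 0

/-- `κ_p(h) = 1 − (2^{-C(p,2)}/Π_{j<p} j!) det_{0≤i,j<p}( (-1)^i H_{i+j}(0) − H_{i+j}(h)e^{-h²} )`. -/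
noncomputable def kappa (p : ℕ) (h : ℝ) : ℝ :=
  1 - (((2:ℝ)^(p.choose 2))⁻¹ / ∏ j ∈ Finset.range p, (j.factorial : ℝ)) *
    Matrix.det (Matrix.of fun i j : Fin p =>
      (-1:ℝ)^(i : ℕ) * hermiteH ((i : ℕ)+(j : ℕ)) 0
        - hermiteH ((i : ℕ)+(j : ℕ)) h * Real.exp (-h^2))

/-- `τ_p(h)`: as `κ_p`, but with the last row of the determinant replaced as in the paper,
and an extra factor `p − 1`. -/
noncomputable def tau (p : ℕ) (h : ℝ) : ℝ :=
  ((p : ℝ) - 1) * (((2:ℝ)^(p.choose 2))⁻¹ / ∏ j ∈ Finset.range p, (j.factorial : ℝ)) *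
    Matrix.det (Matrix.of fun i j : Fin p =>
      if (i : ℕ) < p - 1 then
        (-1:ℝ)^(i : ℕ) * hermiteH ((i : ℕ)+(j : ℕ)) 0
          - hermiteH ((i : ℕ)+(j : ℕ)) h * Real.exp (-h^2)
      else
        (-1:ℝ)^p * hermiteH (p+(j : ℕ)) 0 - hermiteH (p+(j : ℕ)) h * Real.exp (-h^2))

/-- The `s`-th moment of the height of a uniformly random `p`-watermelon of length `2n`. -/
noncomputable def heightMoment (p n s : ℕ) : ℝ :=
  (∑' y : {y : Fin p → Fin (2*n+1) → ℤ // IsMelon p n y}, ((melonHeight y.1 : ℝ))^s) /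
    (Nat.card {y : Fin p → Fin (2*n+1) → ℤ // IsMelon p n y} : ℝ)

open LaurentPolynomial in
noncomputable def wA : LaurentPolynomial ℝ := T 1 + T (-1)

open LaurentPolynomial in
noncomputable def wB : LaurentPolynomial ℝ := T 1 - T (-1)

open LaurentPolynomial in
lemma coeff_T_mul (k : ℤ) (f : LaurentPolynomial ℝ) (d : ℤ) :
    (T k * f).coeff d = f.coeff (d - k) := by
  rw [T, AddMonoidAlgebra.coeff_single_mul_apply]
  rw [one_mul]; congr 1; ring

lemma coeff_wA_mul (f : LaurentPolynomial ℝ) (d : ℤ) :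
    (wA * f).coeff d = f.coeff (d - 1) + f.coeff (d + 1) := by
  rw [wA, add_mul, AddMonoidAlgebra.coeff_add, Finsupp.add_apply, coeff_T_mul, coeff_T_mul]
  norm_num

lemma coeff_wB_mul (f : LaurentPolynomial ℝ) (d : ℤ) :
    (wB * f).coeff d = f.coeff (d - 1) - f.coeff (d + 1) := by
  rw [wB, sub_mul, AddMonoidAlgebra.coeff_sub, Finsupp.sub_apply, coeff_T_mul, coeff_T_mul]
  norm_num

def Ch {p : ℕ} (h : ℤ) (y : Fin p → ℤ) : Prop :=
  (∀ i j, i ≠ j → y i ≠ y j) ∧ ∀ i, y i < h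

def Fam {p : ℕ} (h : ℤ) (t : ℕ) (a y : Fin p → ℤ) : Set (Fin p → Fin (t+1) → ℤ) :=
  {Y | (∀ i, Y i 0 = a i) ∧ (∀ i, Y i (Fin.last t) = y i) ∧
    (∀ i (s : Fin t), Y i s.succ - Y i s.castSucc = 1 ∨ Y i s.succ - Y i s.castSucc = -1) ∧
    ∀ s, Ch h (fun i => Y i s)}

def sg (b : Bool) : ℤ := if b then 1 else -1

lemma fam_snoc {p : ℕ} {h : ℤ} {t : ℕ} {a y : Fin p → ℤ} (hy : Ch h y) (e : Fin p → Bool)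
    (Z : Fin p → Fin (t+1) → ℤ) (hZ : Z ∈ Fam h t a (fun i => y i - sg (e i))) :
    (fun i => (Fin.snoc (Z i) (y i) : Fin (t+1+1) → ℤ)) ∈ Fam h (t+1) a y := by
  obtain ⟨h1, h2, h3, h4⟩ := hZ
  refine ⟨fun i => ?_, fun i => ?_, fun i s => ?_, fun s => ?_⟩
  · beta_reduce
    rw [show (0 : Fin (t+1+1)) = Fin.castSucc 0 from rfl, Fin.snoc_castSucc]; exact h1 i
  · simp
  · refine Fin.lastCases ?_ (fun s => ?_) s
    · beta_reduce
      rw [Fin.succ_last, Fin.snoc_last, Fin.snoc_castSucc, h2 i]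
      beta_reduce
      unfold sg; split_ifs <;> simp
    · beta_reduce
      rw [Fin.succ_castSucc, Fin.snoc_castSucc, Fin.snoc_castSucc]; exact h3 i s
  · refine Fin.lastCases ?_ (fun s => ?_) s
    · simpa using hy
    · simpa using h4 s

lemma fam_succ_bij {p : ℕ} {h : ℤ} {t : ℕ} {a y : Fin p → ℤ} (hy : Ch h y) :
    Function.Bijective (fun x : (Σ e : Fin p → Bool, Fam h t a (fun i => y i - sg (e i))) =>
      (⟨_, fam_snoc hy x.1 x.2.1 x.2.2⟩ : Fam h (t+1) a y)) := by
  constructor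
  · rintro ⟨e, Z, hZ⟩ ⟨e', Z', hZ'⟩ hh
    have hh' := congrArg Subtype.val hh
    have hZZ : Z = Z' := by
      funext i s
      have := congrFun (congrFun hh' i) s.castSucc
      simpa using this
    subst hZZ
    have : e = e' := by
      funext i
      have h1 := hZ.2.1 i
      have h2 := hZ'.2.1 i
      rw [h1] at h2
      simp only [sg] at h2
      revert h2
      cases e i <;> cases e' i <;> simp <;> omega
    subst this
    rfl
  · rintro ⟨Y, hY⟩
    obtain ⟨h1, h2, h3, h4⟩ := hY
    refine ⟨⟨fun i => decide (Y i (Fin.last t).succ - Y i (Fin.last t).castSucc = 1),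
      fun i s => Y i s.castSucc, fun i => h1 i, fun i => ?_, fun i s => ?_, fun s => h4 _⟩, ?_⟩
    · have := h3 i (Fin.last t)
      have h5 := h2 i
      rw [← Fin.succ_last] at h5
      unfold sg
      by_cases hc : Y i (Fin.last t).succ - Y i (Fin.last t).castSucc = 1
      · simp only [hc]; simp; omega
      · simp only [hc]; simp; omega
    · exact h3 i s.castSucc
    · apply Subtype.ext
      funext i s
      refine Fin.lastCases ?_ (fun s => ?_) s
      · simp [h2 i]
      · simp

lemma fam_zero_empty {p : ℕ} {h : ℤ} {t : ℕ} {a y : Fin p → ℤ} (hy : ¬ Ch h y) :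
    Fam h t a y = ∅ := by
  ext Y
  simp only [Set.mem_empty_iff_false, iff_false]
  rintro ⟨h1, h2, h3, h4⟩
  apply hy
  have := h4 (Fin.last t)
  simpa only [h2] using this

lemma fam_finite {p : ℕ} (h : ℤ) (t : ℕ) (a y : Fin p → ℤ) : Finite (Fam h t a y) := by
  induction t generalizing y with
  | zero =>
    have : (Fam h 0 a y).Subsingleton := by
      intro Y hY Y' hY'
      funext i s
      have : s = 0 := Fin.fin_one_eq_zero s
      rw [this, hY.1, hY'.1]
    exact this.finite
  | succ t ih =>
    by_cases hy : Ch h y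
    · exact Finite.of_surjective _ (fam_succ_bij hy).2
    · rw [fam_zero_empty hy]; infer_instance

noncomputable def fK (h : ℤ) (t : ℕ) (a y : ℤ) : ℝ :=
  (wA ^ t).coeff (y - a) - (wA ^ t).coeff (2 * h - y - a)

noncomputable def RK {p : ℕ} (h : ℤ) (t : ℕ) (a y : Fin p → ℤ) : ℝ :=
  Matrix.det (Matrix.of fun j i : Fin p => fK h t (a i) (y j))

lemma fK_succ (h : ℤ) (t : ℕ) (a y : ℤ) :
    fK h (t+1) a y = fK h t a (y - 1) + fK h t a (y + 1) := by
  unfold fK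
  rw [pow_succ', coeff_wA_mul, coeff_wA_mul]
  rw [show y - a - 1 = y - 1 - a by ring, show y - a + 1 = y + 1 - a by ring,
    show 2 * h - y - a - 1 = 2 * h - (y+1) - a by ring,
    show 2 * h - y - a + 1 = 2 * h - (y-1) - a by ring]
  ring

lemma RK_succ {p : ℕ} (h : ℤ) (t : ℕ) (a y : Fin p → ℤ) :
    RK h (t+1) a y = ∑ e : Fin p → Bool, RK h t a (fun i => y i - sg (e i)) := by
  have := (Matrix.detRowAlternating (R := ℝ) (n := Fin p)).toMultilinearMap.map_sum
    (fun (j : Fin p) (b : Bool) => fun i => fK h t (a i) (y j - sg b))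
  unfold RK
  convert this using 1
  · simp only [AlternatingMap.coe_multilinearMap]
    change _ = Matrix.det _
    congr 1
    ext j i
    simp [fK_succ, sg, add_comm]
  · rfl

lemma RK_zero_of_not {p : ℕ} {h : ℤ} {t : ℕ} {a y : Fin p → ℤ} (hy : ¬ Ch h y)
    (hle : ∀ i, y i ≤ h) : RK h t a y = 0 := by
  unfold Ch at hy
  rw [not_and_or] at hy
  push Not at hy
  unfold RK
  rcases hy with ⟨i, j, hij, hh⟩ | ⟨i, hi⟩
  · apply Matrix.det_zero_of_row_eq hij
    funext k
    simp [hh]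
  · apply Matrix.det_eq_zero_of_row_eq_zero i
    intro k
    have : y i = h := le_antisymm (hle i) hi
    simp only [Matrix.of_apply, fK, this]
    rw [show 2 * h - h = h by ring]; simp

lemma count_eq {p : ℕ} {h : ℤ} {a : Fin p → ℤ} (ha : StrictMono a) (hah : ∀ i, a i < h)
    (t : ℕ) (y : Fin p → ℤ) (hm : Monotone y) (hpar : ∀ i j, (2:ℤ) ∣ y i - y j)
    (hle : ∀ i, y i ≤ h) : (Nat.card (Fam h t a y) : ℝ) = RK h t a y := by
  induction t generalizing y with
  | zero =>
    by_cases hy : Ch h y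
    · have hys : StrictMono y := hm.strictMono_of_injective (by
        intro i j hij; by_contra hne; exact hy.1 i j hne hij)
      have hf : ∀ i j, fK h 0 (a i) (y j) = if a i = y j then 1 else 0 := by
        intro i j
        have h1 := hah i
        have h2 := hy.2 j
        unfold fK
        rw [pow_zero, ← LaurentPolynomial.T_zero, LaurentPolynomial.T_apply,
          LaurentPolynomial.T_apply]
        rw [if_neg (show ¬ (0 = 2 * h - y j - a i) by omega), sub_zero]
        congr 1
        simp only [eq_iff_iff]; omega
      by_cases hya : y = a
      · subst hya
        have : RK h 0 y y = 1 := by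
          unfold RK
          convert Matrix.det_one (n := Fin p) (R := ℝ) using 2
          ext j i
          simp only [Matrix.of_apply, hf, hys.injective.eq_iff, Matrix.one_apply, eq_comm]
        rw [this]
        have : Fam h 0 y y = {fun i _ => y i} := by
          ext Y
          simp only [Set.mem_singleton_iff]
          constructor
          · intro hY
            funext i s
            rw [show s = 0 from Fin.fin_one_eq_zero s, hY.1]
          · rintro rfl
            exact ⟨fun i => rfl, fun i => rfl, fun i s => s.elim0, fun s => hy⟩
        rw [this]; simp
      · have h0 : Nat.card (Fam h 0 a y) = 0 := by
          have : Fam h 0 a y = ∅ := by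
            ext Y
            simp only [Set.mem_empty_iff_false, iff_false]
            intro hY
            apply hya
            funext i
            rw [← hY.1, ← hY.2.1]; rfl
          rw [this]; simp
        rw [h0]
        have : ∃ j, ∀ i, a i ≠ y j := by
          by_contra hcon
          push Not at hcon
          apply hya
          choose s hs using hcon
          have hs' : StrictMono s := by
            intro i j hij
            have := hys hij
            rw [← hs, ← hs] at this
            exact ha.lt_iff_lt.1 this
          have : s = id := by
            have := hs'.range_inj strictMono_id |>.1 (by
              rw [Set.range_id]
              exact (Finite.injective_iff_surjective.1 hs'.injective).range_eq)
            exact this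
          funext j
          rw [← hs j, this]; rfl
        obtain ⟨j, hj⟩ := this
        symm
        unfold RK
        rw [Matrix.det_eq_zero_of_row_eq_zero j]
        · simp
        · intro i
          simp [hf, hj]
    · rw [fam_zero_empty hy, RK_zero_of_not hy hle]; simp
  | succ t ih =>
    by_cases hy : Ch h y
    · have hys : StrictMono y := hm.strictMono_of_injective (by
        intro i j hij; by_contra hne; exact hy.1 i j hne hij)
      have := fun s => fam_finite h t a (p := p) s
      rw [← Nat.card_eq_of_bijective _ (fam_succ_bij hy), Nat.card_sigma, RK_succ]
      push_cast
      refine Finset.sum_congr rfl fun e _ => ?_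
      apply ih
      · intro i j hij
        rcases hij.eq_or_lt with rfl | hlt
        · exact le_rfl
        · have h1 := hys hlt
          have h2 := hpar i j
          have h3 : y i + 2 ≤ y j := by omega
          simp only [sg]
          split_ifs <;> omega
      · intro i j
        have := hpar i j
        simp only [sg]
        split_ifs <;> omega
      · intro i
        have := hy.2 i
        simp only [sg]
        split_ifs <;> omega
    · rw [fam_zero_empty hy, RK_zero_of_not hy hle]; simp

def aM (p : ℕ) : Fin p → ℤ := fun i => 2 * (i : ℤ)

noncomputable def WM (p n : ℕ) (h : ℕ) : ℝ := (Nat.card (Fam (h:ℤ) (2*n) (aM p) (aM p)) : ℝ)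

lemma melon_le {p n : ℕ} {y : Fin p → Fin (2*n+1) → ℤ} (hy : IsMelon p n y) (i : Fin p)
    (t : Fin (2*n+1)) : y i t ≤ 2 * i + t := by
  induction t using Fin.induction with
  | zero => simp [hy.1 i]
  | succ t ih =>
    have := hy.2.2.1 i t
    simp only [Fin.val_castSucc, Fin.val_succ] at *
    push_cast
    omega

lemma melon_bdd {p n : ℕ} {y : Fin p → Fin (2*n+1) → ℤ} (hy : IsMelon p n y) (i : Fin p)
    (t : Fin (2*n+1)) : y i t < 2 * n + 2 * p := by
  have := melon_le hy i t
  have := i.2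
  have := t.2
  omega

lemma melon_height_lt {p n : ℕ} (hp : 0 < p) {y : Fin p → Fin (2*n+1) → ℤ} (hy : IsMelon p n y)
    (h : ℤ) : melonHeight y < h ↔ ∀ i t, y i t < h := by
  unfold melonHeight
  have hb : BddAbove {v | ∃ i t, y i t = v} := ⟨2 * n + 2 * p, by
    rintro v ⟨i, t, rfl⟩; exact (melon_bdd hy i t).le⟩
  have hne : {v | ∃ i t, y i t = v}.Nonempty := ⟨_, ⟨0, hp⟩, 0, rfl⟩
  constructor
  · intro hlt i t
    exact lt_of_le_of_lt (le_csSup hb ⟨i, t, rfl⟩) hlt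
  · intro hall
    obtain ⟨i, t, hit⟩ := Int.csSup_mem hne hb
    rw [← hit]; exact hall i t

lemma melon_mem_fam {p n : ℕ} {h : ℤ} {y : Fin p → Fin (2*n+1) → ℤ} :
    y ∈ Fam h (2*n) (aM p) (aM p) ↔ IsMelon p n y ∧ ∀ i t, y i t < h := by
  constructor
  · rintro ⟨h1, h2, h3, h4⟩
    exact ⟨⟨h1, h2, h3, fun i j hij t => (h4 t).1 i j hij⟩, fun i t => (h4 t).2 i⟩
  · rintro ⟨⟨h1, h2, h3, h4⟩, h5⟩
    exact ⟨h1, h2, h3, fun t => ⟨fun i j hij => h4 i j hij t, fun i => h5 i t⟩⟩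

lemma melon_fam_big {p n : ℕ} {h : ℕ} (hh : 2 * n + 2 * p ≤ h) :
    Fam (h:ℤ) (2*n) (aM p) (aM p) = {y | IsMelon p n y} := by
  ext y
  rw [melon_mem_fam]
  constructor
  · exact fun h => h.1
  · intro hy
    refine ⟨hy, fun i t => ?_⟩
    have := melon_bdd hy i t
    omega

lemma expect_eq {p n : ℕ} (hp : 0 < p) {hb L : ℕ} (hh : 2 * n + 2 * p ≤ hb)
    (hL : 2 * n + 2 * p ≤ L) (hpos : WM p n hb ≠ 0) :
    heightMoment p n 1 = ∑ h ∈ Finset.Icc 1 L, (1 - WM p n h / WM p n hb) := by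
  classical
  have hfin : Finite {y : Fin p → Fin (2*n+1) → ℤ // IsMelon p n y} := by
    have := fam_finite (hb:ℤ) (2*n) (aM p) (aM p)
    rw [melon_fam_big hh] at this
    exact this
  have := Fintype.ofFinite {y : Fin p → Fin (2*n+1) → ℤ // IsMelon p n y}
  have hT : WM p n hb = (Nat.card {y : Fin p → Fin (2*n+1) → ℤ // IsMelon p n y} : ℝ) := by
    unfold WM
    rw [melon_fam_big hh]; rfl
  have hW : ∀ h : ℕ, WM p n h = ∑ y : {y : Fin p → Fin (2*n+1) → ℤ // IsMelon p n y},
      if melonHeight y.1 < h then (1:ℝ) else 0 := by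
    intro h
    rw [← Finset.sum_filter, Finset.sum_const, nsmul_eq_mul, mul_one]
    unfold WM
    congr 1
    rw [← Fintype.card_subtype, ← Nat.card_eq_fintype_card]
    refine Nat.card_congr ⟨fun y => ⟨⟨y.1, (melon_mem_fam.1 y.2).1⟩, ?_⟩,
      fun y => ⟨y.1.1, melon_mem_fam.2 ⟨y.1.2, ?_⟩⟩, fun _ => rfl, fun _ => rfl⟩
    · exact (melon_height_lt hp (melon_mem_fam.1 y.2).1 _).2 (melon_mem_fam.1 y.2).2
    · exact (melon_height_lt hp y.1.2 _).1 y.2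
  have hH : ∀ y : {y : Fin p → Fin (2*n+1) → ℤ // IsMelon p n y}, (melonHeight y.1 : ℝ)
      = ∑ h ∈ Finset.Icc 1 L, (1 - if melonHeight y.1 < (h:ℕ) then (1:ℝ) else 0) := by
    intro y
    have h1 : melonHeight y.1 < L := (melon_height_lt hp y.2 _).2 (fun i t => by
      have := melon_bdd y.2 i t; omega)
    have h0 : 0 ≤ melonHeight y.1 := by
      by_contra hneg
      have := (melon_height_lt hp y.2 0).1 (by omega) ⟨0, hp⟩ 0
      rw [y.2.1] at this
      simp at this
    obtain ⟨k, hk⟩ := Int.eq_ofNat_of_zero_le h0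
    rw [hk] at h1 ⊢
    have : ∀ h : ℕ, (1 - if ((k:ℕ):ℤ) < (h:ℕ) then (1:ℝ) else 0) = if h ≤ k then 1 else 0 := by
      intro h
      by_cases hc : h ≤ k
      · rw [if_neg (by omega), if_pos hc]; simp
      · rw [if_pos (by omega), if_neg hc]; simp
    simp_rw [this]
    rw [← Finset.sum_filter, Finset.sum_const, nsmul_eq_mul, mul_one]
    have : (Finset.Icc 1 L).filter (fun h => h ≤ k) = Finset.Icc 1 k := by
      ext h; simp; omega
    rw [this]; simp
  unfold heightMoment
  rw [← hT, tsum_fintype]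
  simp_rw [pow_one, hH]
  rw [Finset.sum_comm, Finset.sum_div]
  refine Finset.sum_congr rfl fun h _ => ?_
  rw [Finset.sum_sub_distrib, ← hW]
  have : (∑ y : {y : Fin p → Fin (2*n+1) → ℤ // IsMelon p n y}, (1:ℝ)) = WM p n hb := by
    rw [hT]; simp
  rw [this, sub_div, div_self hpos]

lemma WM_small {p n h : ℕ} (hp : 0 < p) (hh : h ≤ 2 * p - 2) : WM p n h = 0 := by
  unfold WM
  rw [fam_zero_empty]
  · simp
  · intro hc
    have := hc.2 ⟨p - 1, by omega⟩
    simp only [aM] at this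
    omega

lemma WM_eq {p n h : ℕ} (hp : 0 < p) (hh : 2 * p - 2 < h) :
    WM p n h = RK (h:ℤ) (2*n) (aM p) (aM p) := by
  have hlt : ∀ i, aM p i < (h:ℤ) := by
    intro i; have := i.2; simp only [aM]; omega
  have hs : StrictMono (aM p) := by
    intro i j hij
    simp only [aM]
    have : (i:ℕ) < j := hij
    omega
  exact count_eq hs hlt _ _ hs.monotone (fun i j => by simp only [aM]; omega) (fun i => (hlt i).le)

noncomputable def ccN (N k : ℕ) (H : ℤ) : ℝ := (wA ^ (N - k) * wB ^ k).coeff (2 * H)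

open Polynomial in
noncomputable def bP (q a : ℕ) : ℝ[X] := (X - 1) ^ a * (X + 1) ^ (q - a)

noncomputable def TM (p : ℕ) : Matrix (Fin p) (Fin p) ℝ :=
  Matrix.of fun a j => (bP (p-1) a).coeff j

open Polynomial in
lemma bP_deg {q a : ℕ} (ha : a ≤ q) : (bP q a).natDegree < q + 1 := by
  unfold bP
  have h1 : (X - 1 : ℝ[X]).natDegree = 1 := by
    have := natDegree_X_sub_C (1:ℝ); simpa using this
  have h2 : (X + 1 : ℝ[X]).natDegree = 1 := by
    have := natDegree_X_add_C (1:ℝ); simpa using this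
  have h3 := natDegree_mul_le (p := (X - 1 : ℝ[X]) ^ a) (q := (X + 1 : ℝ[X]) ^ (q-a))
  rw [natDegree_pow, natDegree_pow, h1, h2] at h3
  omega

lemma TM_sum {p : ℕ} (a : Fin p) (U : LaurentPolynomial ℝ) :
    ∑ j : Fin p, TM p a j • U ^ (j:ℕ) = (U - 1) ^ (a:ℕ) * (U + 1) ^ (p - 1 - a) := by
  have hp := a.2
  have h := Polynomial.aeval_eq_sum_range' (p := bP (p-1) a) (n := p)
    (by have := bP_deg (show (a:ℕ) ≤ p - 1 by omega); omega) U
  rw [Finset.sum_range (fun i => (bP (p-1) a).coeff i • U ^ i)] at h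
  simp only [TM, Matrix.of_apply]
  rw [← h]
  simp [bP]

open LaurentPolynomial in
lemma TM_sum_pos {p : ℕ} (a : Fin p) :
    ∑ j : Fin p, TM p a j • T (2 * (j:ℤ)) = T ((p:ℤ) - 1) * (wB ^ (a:ℕ) * wA ^ (p - 1 - a)) := by
  have hp := a.2
  have h := TM_sum a (T 2)
  simp only [T_pow] at h
  have h1 : (T 2 - 1 : LaurentPolynomial ℝ) = T 1 * wB := by
    rw [wB, mul_sub, ← T_add, ← T_add]; norm_num
  have h2 : (T 2 + 1 : LaurentPolynomial ℝ) = T 1 * wA := by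
    rw [wA, mul_add, ← T_add, ← T_add]; norm_num
  rw [h1, h2, mul_pow, mul_pow, mul_mul_mul_comm, ← pow_add, T_pow] at h
  rw [show (((a:ℕ) + (p - 1 - a) : ℕ):ℤ) * 1 = (p:ℤ) - 1 by omega] at h
  rw [← h]
  simp only [mul_comm]

open LaurentPolynomial in
lemma TM_sum_neg {p : ℕ} (a : Fin p) :
    ∑ j : Fin p, TM p a j • T (-(2 * (j:ℤ))) =
      T (-((p:ℤ) - 1)) * ((-1) ^ (a:ℕ) * (wB ^ (a:ℕ) * wA ^ (p - 1 - a))) := by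
  have hp := a.2
  have h := TM_sum a (T (-2))
  simp only [T_pow] at h
  have h1 : (T (-2) - 1 : LaurentPolynomial ℝ) = T (-1) * (-1 * wB) := by
    rw [wB, neg_one_mul, neg_sub, mul_sub, ← T_add, ← T_add]; norm_num
  have h2 : (T (-2) + 1 : LaurentPolynomial ℝ) = T (-1) * wA := by
    rw [wA, mul_add, ← T_add, ← T_add]; norm_num; rw [add_comm]
  rw [h1, h2, mul_pow, mul_pow (T (-1)) wA, mul_mul_mul_comm, ← pow_add, T_pow] at h
  rw [show (((a:ℕ) + (p - 1 - a) : ℕ):ℤ) * (-1) = -((p:ℤ) - 1) by omega] at h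
  rw [mul_pow, mul_assoc ((-1) ^ (a:ℕ))] at h
  rw [← h]
  refine Finset.sum_congr rfl fun j _ => ?_
  rw [show -(2 * (j:ℤ)) = j * (-2) by ring]

open LaurentPolynomial in
lemma basis_change {p : ℕ} (n h : ℕ) (a b : Fin p) :
    ((TM p) * (Matrix.of fun j i : Fin p => fK (h:ℤ) (2*n) (aM p i) (aM p j)) * (TM p).transpose) a b
    = (-1) ^ (a:ℕ) * ccN (2*n+2*(p-1)) (a+b) 0 -
      ccN (2*n+2*(p-1)) (a+b) ((h:ℤ) - ((p:ℤ)-1)) := by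
  have ha := a.2
  have hb := b.2
  set W : LaurentPolynomial ℝ := wA ^ (2*n) with hW
  have hpow : wA ^ (p - 1 - a) * wA ^ (p - 1 - b) * W
      = wA ^ (2*n+2*(p-1) - ((a:ℕ)+b)) := by
    rw [hW, ← pow_add, ← pow_add]; congr 1; omega
  have e1 : ((∑ j : Fin p, TM p a j • T (-(2 * (j:ℤ)))) * (∑ i : Fin p, TM p b i • T (2 * (i:ℤ)))
      * W).coeff 0 = (-1) ^ (a:ℕ) * ccN (2*n+2*(p-1)) (a+b) 0 := by
    rw [TM_sum_neg, TM_sum_pos]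
    unfold ccN
    rw [← hpow]
    have : T (-((p:ℤ) - 1)) * ((-1) ^ (a:ℕ) * (wB ^ (a:ℕ) * wA ^ (p - 1 - a))) *
      (T ((p:ℤ) - 1) * (wB ^ (b:ℕ) * wA ^ (p - 1 - b))) * W = (T (-((p:ℤ) - 1)) * T ((p:ℤ) - 1)) *
       ((-1) ^ (a:ℕ) * (wA ^ (p - 1 - a) * wA ^ (p - 1 - b) * W * wB ^ ((a:ℕ)+b))) := by
      rw [pow_add]; ring
    rw [this, ← T_add, neg_add_cancel, T_zero, one_mul, mul_zero]
    rcases neg_one_pow_eq_or (LaurentPolynomial ℝ) (a:ℕ) with h1 | h1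
    · rcases neg_one_pow_eq_or ℝ (a:ℕ) with h2 | h2
      · rw [h1, h2, one_mul, one_mul]
      · have : ¬ Even (a:ℕ) := fun he => by rw [he.neg_one_pow] at h2; norm_num at h2
        rw [(Nat.not_even_iff_odd.1 this).neg_one_pow, (Nat.not_even_iff_odd.1 this).neg_one_pow]
        simp
    · rcases Nat.even_or_odd (a:ℕ) with he | he
      · rw [he.neg_one_pow, he.neg_one_pow]; simp
      · rw [he.neg_one_pow, he.neg_one_pow]; simp
  have e2 : ((∑ j : Fin p, TM p a j • T (2 * (j:ℤ))) * (∑ i : Fin p, TM p b i • T (2 * (i:ℤ)))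
      * W).coeff (2 * h) = ccN (2*n+2*(p-1)) (a+b) ((h:ℤ) - ((p:ℤ)-1)) := by
    rw [TM_sum_pos, TM_sum_pos]
    unfold ccN
    rw [← hpow]
    have : T ((p:ℤ) - 1) * ((wB ^ (a:ℕ) * wA ^ (p - 1 - a))) *
      (T ((p:ℤ) - 1) * (wB ^ (b:ℕ) * wA ^ (p - 1 - b))) * W = (T ((p:ℤ) - 1) * T ((p:ℤ) - 1)) *
       ((wA ^ (p - 1 - a) * wA ^ (p - 1 - b) * W * wB ^ ((a:ℕ)+b))) := by
      rw [pow_add]; ring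
    rw [this, ← T_add, coeff_T_mul]
    congr 1; ring
  rw [← e1, ← e2]
  simp only [Matrix.mul_apply, Matrix.transpose_apply, Matrix.of_apply, fK, aM]
  simp only [Finset.sum_mul, Finset.mul_sum, AddMonoidAlgebra.coeff_sum, Finsupp.finsetSum_apply]
  rw [← Finset.sum_sub_distrib]
  refine Finset.sum_congr rfl fun i _ => ?_
  rw [← Finset.sum_sub_distrib]
  refine Finset.sum_congr rfl fun j _ => ?_
  have e3 : ∀ (u v : ℝ) (k l d : ℤ), (u • T k * v • T l * W).coeff d
      = u * (v * W.coeff (d - (k + l))) := by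
    intro u v k l d
    rw [smul_mul_smul_comm, smul_mul_assoc, AddMonoidAlgebra.coeff_smul_apply, ← T_add,
      coeff_T_mul, smul_eq_mul, mul_assoc]
  rw [e3, e3]
  rw [show (0 - (-(2 * (j:ℤ)) + 2 * (i:ℤ))) = 2 * (j:ℤ) - 2 * i by ring,
    show (2 * (h:ℤ) - ((2 * (j:ℤ)) + 2 * (i:ℤ))) = 2 * h - 2 * (j:ℤ) - 2 * i by ring]
  ring

lemma WM_det {p n h : ℕ} (hp : 0 < p) (hh : 2 * p - 2 < h) :
    (TM p).det ^ 2 * WM p n h = Matrix.det (Matrix.of fun a b : Fin p =>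
      (-1) ^ (a:ℕ) * ccN (2*n+2*(p-1)) (a+b) 0 -
      ccN (2*n+2*(p-1)) (a+b) ((h:ℤ) - ((p:ℤ)-1))) := by
  have : (Matrix.of fun a b : Fin p =>
      (-1) ^ (a:ℕ) * ccN (2*n+2*(p-1)) (a+b) 0 -
      ccN (2*n+2*(p-1)) (a+b) ((h:ℤ) - ((p:ℤ)-1))) =
      (TM p) * (Matrix.of fun j i : Fin p => fK (h:ℤ) (2*n) (aM p i) (aM p j)) * (TM p).transpose := by
    ext a b
    rw [basis_change]; rfl
  rw [this, Matrix.det_mul, Matrix.det_mul, Matrix.det_transpose, WM_eq hp hh, RK]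
  ring

lemma wA_pow_coeff (t : ℕ) (k : ℤ) : (wA ^ t).coeff (2 * k - t) = ichoose t k := by
  induction t generalizing k with
  | zero =>
    rw [pow_zero, ← LaurentPolynomial.T_zero, LaurentPolynomial.T_apply, ichoose]
    by_cases hk : k = 0
    · subst hk; simp
    · rw [if_neg (by simp; omega)]
      split_ifs with h
      · obtain ⟨l, rfl⟩ := Int.eq_ofNat_of_zero_le h
        have : l ≠ 0 := by omega
        obtain ⟨l', rfl⟩ := Nat.exists_eq_succ_of_ne_zero this
        simp
      · simp
  | succ t ih =>
    rw [pow_succ', coeff_wA_mul]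
    rw [show 2 * k - ((t + 1 : ℕ) : ℤ) - 1 = 2 * (k - 1) - t by push_cast; ring,
      show 2 * k - ((t + 1 : ℕ) : ℤ) + 1 = 2 * k - t by push_cast; ring, ih, ih]
    unfold ichoose
    rcases lt_trichotomy k 0 with h | h | h
    · rw [if_neg (by omega), if_neg (by omega), if_neg (by omega)]; simp
    · subst h; simp
    · obtain ⟨l, hl⟩ : ∃ l : ℕ, k = l + 1 := ⟨(k - 1).toNat, by omega⟩
      subst hl
      rw [if_pos (by omega), if_pos (by omega), if_pos (by omega)]
      rw [show ((l:ℤ) + 1 - 1).toNat = l by omega, show ((l:ℤ) + 1).toNat = l + 1 by omega,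
        Nat.choose_succ_succ]
      push_cast; ring

lemma ccN_zero (m H : ℕ) : ccN (2*m) 0 H = ((2*m).choose (m + H) : ℝ) := by
  unfold ccN
  rw [pow_zero, mul_one, Nat.sub_zero]
  have := wA_pow_coeff (2*m) (m + H)
  rw [show 2 * ((m:ℤ) + H) - ((2*m : ℕ):ℤ) = 2 * H by push_cast; ring] at this
  rw [this, ichoose, if_pos (by omega)]
  congr 2

def IsDv (f g : LaurentPolynomial ℝ) : Prop := ∀ d : ℤ, g.coeff d = d * f.coeff d

lemma isDv_A {f g : LaurentPolynomial ℝ} (h : IsDv f g) : IsDv (wA * f) (wA * g + wB * f) := by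
  intro d
  rw [AddMonoidAlgebra.coeff_add, Finsupp.add_apply, coeff_wA_mul, coeff_wA_mul, coeff_wB_mul,
    h, h]
  push_cast; ring

lemma isDv_B {f g : LaurentPolynomial ℝ} (h : IsDv f g) : IsDv (wB * f) (wB * g + wA * f) := by
  intro d
  rw [AddMonoidAlgebra.coeff_add, Finsupp.add_apply, coeff_wA_mul, coeff_wB_mul, coeff_wB_mul,
    h, h]
  push_cast; ring

lemma isDv_one : IsDv 1 0 := by
  intro d
  rw [← LaurentPolynomial.T_zero, LaurentPolynomial.T_apply]
  by_cases h : (0:ℤ) = d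
  · subst h; simp
  · simp [h]

lemma isDv_B_pow (k : ℕ) : IsDv (wB ^ k) (k • (wA * wB ^ (k - 1))) := by
  induction k with
  | zero => simpa using isDv_one
  | succ k ih =>
    have := isDv_B ih
    rw [← pow_succ'] at this
    convert this using 1
    rcases k with _ | k
    · simp
    · simp only [Nat.add_sub_cancel, nsmul_eq_mul]
      push_cast; ring

lemma isDv_AB (j k : ℕ) : IsDv (wA ^ j * wB ^ k)
    (j • (wA ^ (j-1) * wB ^ (k+1)) + k • (wA ^ (j+1) * wB ^ (k - 1))) := by
  induction j with
  | zero => simpa using isDv_B_pow k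
  | succ j ih =>
    have := isDv_A ih
    rw [← mul_assoc, ← pow_succ'] at this
    convert this using 1
    rcases j with _ | j
    · simp only [nsmul_eq_mul]; push_cast; simp; ring
    · simp only [Nat.add_sub_cancel, nsmul_eq_mul]
      push_cast; ring

lemma ccN_rec (N k : ℕ) (hk : k < N) (H : ℤ) :
    2 * H * ccN N k H = ((N:ℝ) - k) * ccN N (k+1) H + k * ccN N (k-1) H := by
  have := isDv_AB (N - k) k (2 * H)
  rw [AddMonoidAlgebra.coeff_add, Finsupp.add_apply, AddMonoidAlgebra.coeff_smul_apply,
    AddMonoidAlgebra.coeff_smul_apply] at this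
  unfold ccN
  push_cast at this
  rw [← this, show N - (k + 1) = N - k - 1 by omega]
  simp only [nsmul_eq_mul]
  rw [Nat.cast_sub hk.le]
  rcases k with _ | k
  · simp
  · rw [show N - (k+1-1) = N - (k+1) + 1 by omega]

noncomputable def rr (M : ℝ) : ℕ → ℝ → ℝ
  | 0, _ => 1
  | 1, x => 4 * M / (2 * M - 1) * x
  | k+2, x => 4 * M / (2 * M - 1 - (k+1)) * (x * rr M (k+1) x - (k+1) * rr M k x)

lemma ccN_rr (m : ℕ) (k : ℕ) (hk : k ≤ 2 * m) (H : ℤ) :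
    ccN (2*m) k H * (2 * √((m:ℝ)+1/2)) ^ k =
      ccN (2*m) 0 H * rr ((m:ℝ)+1/2) k (H / √((m:ℝ)+1/2)) := by
  set M : ℝ := (m:ℝ) + 1/2 with hM
  have hM0 : 0 < M := by positivity
  have hs : √M * √M = M := Real.mul_self_sqrt hM0.le
  have hs0 : 0 < √M := Real.sqrt_pos.2 hM0
  have hx : (H:ℝ) = (H / √M) * √M := by field_simp
  set x := (H:ℝ) / √M
  induction k using Nat.strong_induction_on with
  | _ k ih =>
    match k, ih, hk with
    | 0, _, _ => simp [rr]
    | 1, _, hk =>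
      have h := ccN_rec (2*m) 0 (by omega) H
      have h2 : (2 * m : ℝ) = 2 * M - 1 := by rw [hM]; ring
      have h3 : (2 * M - 1) ≠ 0 := by
        rw [← h2]; have : 0 < m := by omega
        positivity
      simp only [rr, pow_one]
      push_cast at h
      rw [h2, hx] at h
      simp only [sub_zero, zero_mul, add_zero, zero_add] at h
      field_simp
      linear_combination (-2 * √M) * h + 4 * x * ccN (2*m) 0 H * hs
    | k+2, ih, hk =>
      have h := ccN_rec (2*m) (k+1) (by omega) H
      have h1 := ih (k+1) (by omega) (by omega)
      have h0 := ih k (by omega) (by omega)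
      have h2 : (2 * m : ℝ) = 2 * M - 1 := by rw [hM]; ring
      have h3 : (2 * M - 1 - (k+1)) ≠ 0 := by
        rw [← h2]
        have : ((k + 1 : ℕ) : ℝ) < ((2*m : ℕ) : ℝ) := by exact_mod_cast (by omega)
        push_cast at this
        linarith
      simp only [rr]
      push_cast at h
      rw [h2, hx] at h
      field_simp
      have e : (2 * √M) ^ (k+2) = (2 * √M) ^ k * (4 * (√M * √M)) := by ring
      have e1 : (2 * √M) ^ (k+1) = (2 * √M) ^ k * (2 * √M) := by ring
      rw [e1] at h1
      rw [e, hs]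
      rw [show k + 1 + 1 = k + 2 from rfl] at h
      linear_combination (-(2 * √M) ^ k * 4 * M) * h + 4 * M * x * h1 - 4 * M * (k+1) * h0

noncomputable def bet (m H : ℕ) : ℝ := ((2*m).choose (m+H) : ℝ) / ((2*m).choose m : ℝ)

noncomputable def MM (p : ℕ) (m : ℕ) : Matrix (Fin p) (Fin p) ℝ :=
  Matrix.of fun a b => (-1) ^ (a:ℕ) * rr ((m:ℝ)+1/2) (a+b) 0

noncomputable def JJ (p : ℕ) (m H : ℕ) : Matrix (Fin p) (Fin p) ℝ :=
  Matrix.of fun a b => rr ((m:ℝ)+1/2) (a+b) (H / √((m:ℝ)+1/2)) * bet m H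

lemma WM_det2 {p : ℕ} (hp : 0 < p) (n : ℕ) : ∃ K : ℝ, K ≠ 0 ∧ ∀ H : ℕ, p ≤ H →
    (TM p).det ^ 2 * WM p n (H + (p-1)) =
      K * (MM p (n + (p-1)) - JJ p (n+(p-1)) H).det := by
  set m := n + (p-1) with hm
  set s : ℝ := 2 * √((m:ℝ)+1/2) with hs
  have hs0 : s ≠ 0 := by
    have : 0 < √((m:ℝ)+1/2) := Real.sqrt_pos.2 (by positivity)
    positivity
  have hc0 : ((2*m).choose m : ℝ) ≠ 0 := by
    have : 0 < (2*m).choose m := Nat.choose_pos (by omega)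
    positivity
  refine ⟨(∏ a : Fin p, (((2*m).choose m : ℝ) * (s ^ (a:ℕ))⁻¹)) * ∏ b : Fin p, (s ^ (b:ℕ))⁻¹,
    ?_, fun H hH => ?_⟩
  · refine mul_ne_zero (Finset.prod_ne_zero_iff.2 fun a _ => mul_ne_zero hc0 (inv_ne_zero (pow_ne_zero _ hs0)))
      (Finset.prod_ne_zero_iff.2 fun a _ => inv_ne_zero (pow_ne_zero _ hs0))
  · rw [WM_det hp (by omega), mul_assoc, ← Matrix.det_mul_row, ← Matrix.det_mul_column]
    congr 1
    ext a b
    have ha := a.2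
    have hb := b.2
    simp only [Matrix.of_apply, MM, JJ, Matrix.sub_apply]
    rw [show 2 * n + 2 * (p-1) = 2 * m by omega]
    rw [show (((H + (p-1) : ℕ) : ℤ) - ((p:ℤ) - 1)) = ((H:ℕ):ℤ) by omega]
    have e1 := ccN_rr m (a+b) (by omega) ((0:ℕ):ℤ)
    have e2 := ccN_rr m (a+b) (by omega) (H:ℤ)
    rw [ccN_zero] at e1 e2
    rw [← hs] at e1 e2
    simp only [Nat.cast_zero, Int.cast_zero, zero_div, add_zero, Int.cast_natCast] at e1 e2
    have hp1 : s ^ (a:ℕ) ≠ 0 := pow_ne_zero _ hs0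
    have hp2 : s ^ (b:ℕ) ≠ 0 := pow_ne_zero _ hs0
    rw [pow_add] at e1 e2
    unfold bet
    generalize rr ((m:ℝ)+1/2) ((a:ℕ)+b) 0 = r0 at e1 e2 ⊢
    generalize rr ((m:ℝ)+1/2) ((a:ℕ)+b) (H/√((m:ℝ)+1/2)) = r1 at e1 e2 ⊢
    field_simp
    linear_combination (-1) ^ (a:ℕ) * e1 - e2

lemma WM_ratio {p : ℕ} (hp : 0 < p) (n : ℕ) (hdet : (MM p (n + (p-1))).det ≠ 0) :
    WM p n (2*n+3*p) ≠ 0 ∧ ∀ H : ℕ, p ≤ H → WM p n (H + (p-1)) / WM p n (2*n+3*p) =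
      (MM p (n + (p-1)) - JJ p (n+(p-1)) H).det / (MM p (n + (p-1))).det := by
  obtain ⟨K, hK, h⟩ := WM_det2 hp n
  have hbig := h (2*n+3*p-(p-1)) (by omega)
  rw [show 2*n+3*p-(p-1) + (p-1) = 2*n+3*p by omega] at hbig
  have hJ : JJ p (n+(p-1)) (2*n+3*p-(p-1)) = 0 := by
    ext a b
    simp only [JJ, bet, Matrix.of_apply, Matrix.zero_apply]
    rw [Nat.choose_eq_zero_of_lt (by omega)]; simp
  rw [hJ, sub_zero] at hbig
  have hne : (TM p).det ^ 2 * WM p n (2*n+3*p) ≠ 0 := by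
    rw [hbig]; exact mul_ne_zero hK hdet
  have h1 := left_ne_zero_of_mul hne
  have h2 := right_ne_zero_of_mul hne
  refine ⟨h2, fun H hH => ?_⟩
  have h3 := h H hH
  rw [div_eq_div_iff h2 hdet]
  apply mul_left_cancel₀ h1
  apply mul_left_cancel₀ hK
  linear_combination K * (MM p (n + (p-1))).det * h3 -
    K * (MM p (n + (p-1)) - JJ p (n+(p-1)) H).det * hbig

noncomputable def kap (p m H : ℕ) : ℝ := ((MM p m).det - (MM p m - JJ p m H).det) / (MM p m).det

lemma expect_kap {p : ℕ} (hp : 0 < p) (n : ℕ) (hdet : (MM p (n + (p-1))).det ≠ 0) (L : ℕ)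
    (hL : 2 * n + 2 * p ≤ L) :
    heightMoment p n 1 = 2 * ((p:ℝ) - 1) + ∑ H ∈ Finset.Icc p L, kap p (n+(p-1)) H := by
  obtain ⟨h1, h2⟩ := WM_ratio hp n hdet
  rw [expect_eq hp (hb := 2*n+3*p) (L := L + (p-1)) (by omega) (by omega) h1]
  have : Finset.Icc 1 (L + (p-1)) = Finset.Icc 1 (2*p-2) ∪
      (Finset.Icc p L).image (fun H => H + (p-1)) := by
    ext h
    simp only [Finset.mem_Icc, Finset.mem_union, Finset.mem_image]
    constructor
    · rintro ⟨ha, hb⟩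
      by_cases hc : h ≤ 2*p-2
      · left; omega
      · right; exact ⟨h - (p-1), by omega, by omega⟩
    · rintro (h | ⟨H, hH, rfl⟩) <;> omega
  rw [this, Finset.sum_union, Finset.sum_image]
  · congr 1
    · rw [Finset.sum_congr rfl (g := fun _ => (1:ℝ))]
      · simp
        rw [Nat.cast_sub (by omega)]; push_cast; ring
      · intro h hh
        rw [Finset.mem_Icc] at hh
        rw [WM_small hp hh.2]; simp
    · refine Finset.sum_congr rfl fun H hH => ?_
      rw [Finset.mem_Icc] at hH
      rw [h2 H hH.1, kap, sub_div, div_self hdet]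
  · intro a _ b _ hab
    simpa using hab
  · rw [Finset.disjoint_left]
    intro h hh
    simp only [Finset.mem_Icc, Finset.mem_image] at *
    rintro ⟨H, hH, rfl⟩
    omega

noncomputable def hT (y : ℝ) (k j : ℕ) : ℝ :=
  if 2 * j ≤ k then (-1:ℝ)^j / j.factorial * (y ^ (k - 2*j) / (k-2*j).factorial) else 0

lemma hermiteH_eq (k : ℕ) (z : ℝ) (R : ℕ) (hR : k < R) :
    hermiteH k z = k.factorial * ∑ j ∈ Finset.range R, hT (2*z) k j := by
  unfold hermiteH
  congr 1
  rw [← Finset.sum_range_reflect]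
  have : ∑ j ∈ Finset.range R, hT (2*z) k j = ∑ j ∈ Finset.range (k+1), hT (2*z) k j := by
    symm
    apply Finset.sum_subset
    · intro j; simp; omega
    · intro j _ hj
      simp at hj
      rw [hT, if_neg (by omega)]
  rw [this]
  refine Finset.sum_congr rfl fun j hj => ?_
  simp at hj
  unfold hT
  by_cases h : 2 * j ≤ k
  · rw [if_pos h, if_pos (by omega), show k - (k + 1 - 1 - j) = j by omega,
      show 2 * (k + 1 - 1 - j) - k = k - 2 * j by omega]
  · rw [if_neg h, if_neg (by omega)]

lemma hT_rec0 (y : ℝ) (k : ℕ) : ((k:ℝ)+1) * hT y (k+1) 0 = y * hT y k 0 := by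
  unfold hT
  simp
  rw [Nat.factorial_succ]
  push_cast
  have : (k.factorial : ℝ) ≠ 0 := by positivity
  field_simp
  ring

lemma hT_rec (y : ℝ) (k j : ℕ) : ((k:ℝ)+2) * hT y (k+2) (j+1) = y * hT y (k+1) (j+1) - 2 * hT y k j := by
  unfold hT
  by_cases h : 2 * j ≤ k
  · rw [if_pos h, if_pos (by omega)]
    obtain ⟨l, rfl⟩ := Nat.exists_eq_add_of_le h
    have f1 : (j.factorial : ℝ) ≠ 0 := by positivity
    have f2 : (l.factorial : ℝ) ≠ 0 := by positivity
    rw [show 2 * j + l + 2 - 2 * (j+1) = l by omega, show 2 * j + l - 2 * j = l by omega]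
    rcases l with _ | l
    · rw [if_neg (by omega)]
      rw [Nat.factorial_succ]
      push_cast
      field_simp
      ring
    · rw [if_pos (by omega), show 2 * j + (l+1) + 1 - 2 * (j+1) = l by omega]
      have f3 : (l.factorial : ℝ) ≠ 0 := by positivity
      rw [Nat.factorial_succ, Nat.factorial_succ]
      push_cast
      field_simp
      ring
  · rw [if_neg h, if_neg (by omega), if_neg (by omega)]; simp

lemma hermiteH_zero (z : ℝ) : hermiteH 0 z = 1 := by simp [hermiteH]
lemma hermiteH_one (z : ℝ) : hermiteH 1 z = 2 * z := by simp [hermiteH, Finset.sum_range_succ]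

lemma hermiteH_rec (k : ℕ) (z : ℝ) :
    hermiteH (k+2) z = 2 * (z * hermiteH (k+1) z - (k+1) * hermiteH k z) := by
  rw [hermiteH_eq (k+2) z (k+3+1) (by omega), hermiteH_eq (k+1) z (k+3+1) (by omega),
    hermiteH_eq k z (k+3) (by omega), Finset.sum_range_succ' (fun j => hT (2*z) (k+2) j),
    Finset.sum_range_succ' (fun j => hT (2*z) (k+1) j)]
  have h0 := hT_rec0 (2*z) (k+1)
  have h1 : ((k:ℝ)+2) * ∑ j ∈ Finset.range (k+3), hT (2*z) (k+2) (j+1) =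
      2 * z * (∑ j ∈ Finset.range (k+3), hT (2*z) (k+1) (j+1))
        - 2 * ∑ j ∈ Finset.range (k+3), hT (2*z) k j := by
    rw [Finset.mul_sum, Finset.mul_sum, Finset.mul_sum, ← Finset.sum_sub_distrib]
    exact Finset.sum_congr rfl fun j _ => hT_rec _ _ _
  rw [Nat.factorial_succ (k+1), Nat.factorial_succ k]
  push_cast at *
  linear_combination ((k:ℝ)+1) * (k.factorial) * h1 + ((k:ℝ)+1) * (k.factorial) * h0

noncomputable def lL : ℕ → ℕ → ℝ
  | 0, k => if k = 0 then 1 else 0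
  | i+1, 0 => -2 * lL i 1
  | i+1, k+1 => lL i k - 2 * (k+2) * lL i (k+2)

lemma lL_tri (i k : ℕ) (h : i < k) : lL i k = 0 := by
  induction i generalizing k with
  | zero => simp [lL]; omega
  | succ i ih =>
    rcases k with _ | k
    · omega
    · rw [lL, ih _ (by omega), ih _ (by omega)]; ring

lemma lL_diag (i : ℕ) : lL i i = 1 := by
  induction i with
  | zero => simp [lL]
  | succ i ih => rw [lL, ih, lL_tri i (i+2) (by omega)]; ring

lemma lL_shift (i k : ℕ) : ((k:ℝ)+1) * lL (i+1) (k+1) = (i+1) * lL i k := by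
  induction i generalizing k with
  | zero => rcases k with _ | k <;> simp [lL]
  | succ i ih =>
    have hk : lL (i+1+1) (k+1) = lL (i+1) k - 2*(k+2)*lL (i+1) (k+2) := by rw [lL]
    rw [hk]
    have h2 := ih (k+1)
    rcases k with _ | k
    · have hdef : lL (i+1) 0 = -2 * lL i 1 := by rw [lL]
      rw [hdef]
      push_cast at *
      linear_combination -2 * h2
    · have h1 := ih k
      have hdef : lL (i+1) (k+1) = lL i k - 2*(k+2)*lL i (k+2) := by rw [lL]
      push_cast at *
      linear_combination h1 - 2*(k+2)*h2 - (i+1)*hdef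

lemma lL_herm (k : ℕ) : lL k 0 = hermiteH k 0 := by
  induction k using Nat.strong_induction_on with
  | _ k ih =>
    match k, ih with
    | 0, _ => simp [lL, hermiteH_zero]
    | 1, _ => simp [lL, hermiteH_one]
    | k+2, ih =>
      rw [hermiteH_rec, ← ih k (by omega), lL]
      have := lL_shift k 0
      simp at this ⊢
      rw [this]

noncomputable def dL (k : ℕ) : ℝ := 2 ^ k * k.factorial

lemma dL_succ (k : ℕ) : dL (k+1) = 2 * (k+1) * dL k := by
  unfold dL; rw [Nat.factorial_succ]; push_cast; ring

noncomputable def sL (K i j : ℕ) : ℝ := ∑ k ∈ Finset.range K, lL i k * dL k * lL j k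

lemma sL_succ (K i j : ℕ) (hj : j ≤ K) (hi : i ≤ K) : sL (K+1) (i+1) j =
    ∑ k ∈ Finset.range K, (lL i k * dL (k+1) * lL j (k+1) - lL i (k+1) * dL (k+1) * lL j k) := by
  unfold sL
  rw [Finset.sum_range_succ', Finset.sum_sub_distrib]
  have h1 : ∑ k ∈ Finset.range K, lL (i+1) (k+1) * dL (k+1) * lL j (k+1) =
     ∑ k ∈ Finset.range K, lL i k * dL (k+1) * lL j (k+1) -
     ∑ k ∈ Finset.range K, lL i (k+1+1) * dL (k+1+1) * lL j (k+1) := by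
    rw [← Finset.sum_sub_distrib]
    refine Finset.sum_congr rfl fun k _ => ?_
    rw [lL, dL_succ (k+1)]; push_cast; ring
  have h2 : ∑ k ∈ Finset.range K, lL i (k+1+1) * dL (k+1+1) * lL j (k+1) +
      lL i (0+1) * dL (0+1) * lL j 0
      = ∑ k ∈ Finset.range K, lL i (k+1) * dL (k+1) * lL j k := by
    rw [← Finset.sum_range_succ' (fun k => lL i (k+1) * dL (k+1) * lL j k), Finset.sum_range_succ,
      lL_tri i (K+1) (by omega)]; ring
  rw [h1, ← h2, lL, dL_succ 0]; push_cast; ring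

lemma sL_comm (K i j : ℕ) : sL K i j = sL K j i := by
  unfold sL; exact Finset.sum_congr rfl fun k _ => by ring

lemma sL_herm (K i j : ℕ) (h : i + j ≤ K) : sL (K+1) i j = (-1) ^ i * hermiteH (i+j) 0 := by
  induction i generalizing j with
  | zero =>
    unfold sL
    rw [Finset.sum_eq_single 0]
    · simp [lL, dL, lL_herm]
    · intro k _ hk; simp [lL, hk]
    · simp
  | succ i ih =>
    have h1 : sL (K+1) (i+1) j = - sL (K+1) i (j+1) := by
      rw [sL_comm _ i, sL_succ _ _ _ (by omega) (by omega), sL_succ _ _ _ (by omega) (by omega),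
        ← Finset.sum_neg_distrib]
      exact Finset.sum_congr rfl fun k _ => by ring
    rw [h1, ih _ (by omega), show i + (j+1) = i + 1 + j by ring]; ring

noncomputable def MI (p : ℕ) : Matrix (Fin p) (Fin p) ℝ :=
  Matrix.of fun i j => (-1:ℝ)^(i : ℕ) * hermiteH ((i : ℕ)+(j : ℕ)) 0

lemma MI_det (p : ℕ) : (MI p).det = 2 ^ (p.choose 2) * ∏ j ∈ Finset.range p, (j.factorial : ℝ) := by
  have h : MI p = (Matrix.of fun i k : Fin p => lL i k) * Matrix.diagonal (fun k : Fin p => dL k) *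
      (Matrix.of fun i k : Fin p => lL i k).transpose := by
    ext i j
    simp only [MI, Matrix.of_apply]
    rw [Matrix.mul_apply]
    simp only [Matrix.mul_diagonal, Matrix.transpose_apply, Matrix.of_apply]
    rw [← sL_herm (i+j+p) i j (by omega), sL,
      ← Finset.sum_range (fun k => lL i k * dL k * lL j k)]
    symm
    apply Finset.sum_subset
    · intro k; simp; omega
    · intro k _ hk
      simp at hk
      rw [lL_tri i k (by omega)]; simp
  have ht : (Matrix.of fun i k : Fin p => lL i k).det = 1 := by
    rw [Matrix.det_of_isLowerTriangular]
    · simp [lL_diag]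
    · intro i j hij
      exact lL_tri _ _ hij
  rw [h, Matrix.det_mul, Matrix.det_mul, Matrix.det_transpose, ht, Matrix.det_diagonal, one_mul,
    mul_one, ← Finset.prod_range (fun k => dL k)]
  unfold dL
  rw [Finset.prod_mul_distrib, Finset.prod_pow_eq_pow_sum]
  congr 2
  rw [Finset.sum_range_id, Nat.choose_two_right]

lemma MI_det_pos (p : ℕ) : 0 < (MI p).det := by
  rw [MI_det]
  refine mul_pos (by positivity) (Finset.prod_pos fun j _ => by positivity)

lemma el_up (y : ℝ) (h0 : 0 ≤ y) (h1 : y ≤ 1) : 1 - y ≤ (1 + y) * Real.exp (-(2*y)) := by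
  rcases h1.eq_or_lt with rfl | h1
  · have := Real.exp_pos (-(2*1)); norm_num; positivity
  have hs := Real.hasSum_log_sub_log_of_abs_lt_one (x := y) (by rw [abs_lt]; constructor <;> linarith)
  have h := le_hasSum hs 0 (fun k _ => by positivity)
  simp at h
  have e : Real.exp (2*y) ≤ (1+y)/(1-y) := by
    rw [← Real.exp_log (show 0 < (1+y)/(1-y) by apply div_pos <;> linarith)]
    apply Real.exp_le_exp.2
    rw [Real.log_div (by linarith) (by linarith)]; exact h
  rw [le_div_iff₀ (by linarith)] at e
  rw [Real.exp_neg, ← div_eq_mul_inv, le_div_iff₀ (Real.exp_pos _)]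
  linarith

lemma el_lo (y : ℝ) (h0 : 0 ≤ y) (h1 : y ≤ 1) :
    Real.exp (-(2*y)) * (1 - 2 * y^3) * (1 + y) ≤ 1 - y := by
  have e := Real.quadratic_le_exp_of_nonneg (x := 2*y) (by linarith)
  have hp := Real.exp_pos (2*y)
  rw [Real.exp_neg, mul_assoc, inv_mul_le_iff₀ hp]
  have : (1 + 2*y + (2*y)^2/2) * (1-y) ≤ Real.exp (2*y) * (1-y) :=
    mul_le_mul_of_nonneg_right e (by linarith)
  nlinarith [pow_nonneg h0 4]

lemma bet_zero (m : ℕ) : bet m 0 = 1 := by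
  have : 0 < (2*m).choose m := Nat.choose_pos (by omega)
  unfold bet
  rw [add_zero, div_self (by positivity)]

lemma bet_big (m H : ℕ) (h : m < H) : bet m H = 0 := by
  unfold bet; rw [Nat.choose_eq_zero_of_lt (by omega)]; simp

lemma bet_nonneg (m H : ℕ) : 0 ≤ bet m H := by unfold bet; positivity

lemma bet_succ (m H : ℕ) (h : H ≤ m) :
    bet m (H+1) * (1 + ((H:ℝ)+1/2)/((m:ℝ)+1/2)) = bet m H * (1 - ((H:ℝ)+1/2)/((m:ℝ)+1/2)) := by
  have e := Nat.choose_succ_right_eq (2*m) (m+H)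
  rw [show 2 * m - (m+H) = m - H by omega] at e
  have e' : ((2*m).choose (m+H+1) : ℝ) * ((m:ℝ)+H+1) = (2*m).choose (m+H) * ((m:ℝ)-H) := by
    have := congrArg (Nat.cast : ℕ → ℝ) e
    push_cast [Nat.cast_sub h] at this
    exact this
  have : ((2*m).choose m : ℝ) ≠ 0 := by
    have : 0 < (2*m).choose m := Nat.choose_pos (by omega)
    positivity
  have hM : (m:ℝ) + 1/2 ≠ 0 := by positivity
  unfold bet
  rw [← add_assoc]
  generalize ((2*m).choose (m+H+1) : ℝ) = a at *
  generalize ((2*m).choose (m+H) : ℝ) = b at *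
  field_simp
  linear_combination 2 * e'

lemma bet_bounds (m H : ℕ) : bet m H ≤ Real.exp (-((H:ℝ)^2/((m:ℝ)+1/2))) ∧
    Real.exp (-((H:ℝ)^2/((m:ℝ)+1/2))) * (1 - 2 * (H:ℝ)^4/((m:ℝ)+1/2)^3) ≤ bet m H := by
  have hM : 0 < (m:ℝ) + 1/2 := by positivity
  induction H with
  | zero => simp [bet_zero]
  | succ H ih =>
    obtain ⟨i1, i2⟩ := ih
    set y := ((H:ℝ)+1/2)/((m:ℝ)+1/2) with hy
    have hy0 : 0 ≤ y := by positivity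
    have he : Real.exp (-(((H+1:ℕ):ℝ)^2/((m:ℝ)+1/2))) =
        Real.exp (-((H:ℝ)^2/((m:ℝ)+1/2))) * Real.exp (-(2*y)) := by
      rw [← Real.exp_add, hy]; congr 1; push_cast; field_simp; ring
    rw [he]
    set A := Real.exp (-((H:ℝ)^2/((m:ℝ)+1/2)))
    have hA : 0 < A := Real.exp_pos _
    have hE := Real.exp_pos (-(2*y))
    have hA4 : 2 * (H:ℝ)^4/((m:ℝ)+1/2)^3 + 2 * y^3 ≤ 2 * (((H+1:ℕ):ℝ))^4/((m:ℝ)+1/2)^3 := by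
      rw [hy, div_pow, mul_div_assoc, mul_div_assoc, ← mul_add, ← add_div]
      push_cast
      gcongr
      have : (0:ℝ) ≤ H := by positivity
      nlinarith [pow_nonneg this 2, pow_nonneg this 3]
    by_cases h : H ≤ m
    · have hs := bet_succ m H h
      rw [← hy] at hs
      have hy1 : y ≤ 1 := by
        rw [hy, div_le_one hM]
        have : (H:ℝ) ≤ m := by exact_mod_cast h
        linarith
      constructor
      · have := el_up y hy0 hy1
        have h3 : bet m (H+1) * (1+y) ≤ A * Real.exp (-(2*y)) * (1 + y) := by
          rw [hs]
          calc _ ≤ A * (1-y) := by gcongr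
            _ ≤ A * ((1 + y) * Real.exp (-(2*y))) := by gcongr
            _ = _ := by ring
        exact le_of_mul_le_mul_right h3 (by linarith)
      · by_cases hB : 1 - 2 * (H:ℝ)^4/((m:ℝ)+1/2)^3 ≤ 0
        · refine le_trans ?_ (bet_nonneg _ _)
          apply mul_nonpos_of_nonneg_of_nonpos (by positivity)
          have : 0 ≤ y^3 := by positivity
          linarith
        · push Not at hB
          set B := 2 * (H:ℝ)^4/((m:ℝ)+1/2)^3 with hBd
          have hB0 : 0 ≤ B := by positivity
          have := el_lo y hy0 hy1
          have h3 : A * Real.exp (-(2*y)) * (1 - B - 2 * y^3) * (1 + y) ≤ bet m (H+1) * (1+y) := by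
            rw [hs]
            calc _ ≤ A * Real.exp (-(2*y)) * ((1 - B) * (1 - 2 * y^3)) * (1 + y) := by
                  gcongr
                  nlinarith [pow_nonneg hy0 3]
              _ = A * (1-B) * (Real.exp (-(2*y)) * (1 - 2 * y^3) * (1 + y)) := by ring
              _ ≤ A * (1-B) * (1 - y) := by gcongr
              _ ≤ _ := by gcongr
          refine le_trans ?_ (le_of_mul_le_mul_right h3 (by linarith))
          apply mul_le_mul_of_nonneg_left _ (by positivity)
          linarith
    · push Not at h
      rw [bet_big m (H+1) (by omega)]
      refine ⟨by positivity, ?_⟩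
      apply mul_nonpos_of_nonneg_of_nonpos (by positivity)
      rw [sub_nonpos, le_div_iff₀ (by positivity), one_mul]
      have h1 : (m:ℝ) + 1/2 ≤ ((H+1:ℕ):ℝ) := by
        have : (m:ℝ) ≤ H := by exact_mod_cast h.le
        push_cast; linarith
      have h2 : (1:ℝ) ≤ ((H+1:ℕ):ℝ) := by push_cast; linarith [Nat.cast_nonneg (α := ℝ) H]
      calc ((m:ℝ)+1/2)^3 ≤ ((H+1:ℕ):ℝ)^3 := by gcongr
        _ ≤ ((H+1:ℕ):ℝ)^4 := pow_le_pow_right₀ h2 (by omega)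
        _ ≤ _ := by linarith [show 0 ≤ ((H+1:ℕ):ℝ)^4 by positivity]

def Cls (g u v : ℕ → ℕ → ℝ) : Prop := (∀ m H, 0 ≤ g m H) ∧ ∃ C : ℝ, ∃ m0 : ℕ, 0 ≤ C ∧
  ∀ m : ℕ, m0 ≤ m → ∀ H : ℕ, |u m H - v m H| ≤ C / ((m:ℝ)+1/2) * g m H ∧ |v m H| ≤ C * g m H

lemma Cls.mul {g u v g' u' v' : ℕ → ℕ → ℝ} (h : Cls g u v) (h' : Cls g' u' v') :
    Cls (fun m H => g m H * g' m H) (fun m H => u m H * u' m H) (fun m H => v m H * v' m H) := by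
  obtain ⟨hg, C, m0, hC, h⟩ := h
  obtain ⟨hg', C', m0', hC', h'⟩ := h'
  refine ⟨fun m H => mul_nonneg (hg _ _) (hg' _ _), 4 * (C * C'), max m0 m0', by positivity,
    fun m hm H => ?_⟩
  obtain ⟨a1, a2⟩ := h m (le_trans (le_max_left _ _) hm) H
  obtain ⟨b1, b2⟩ := h' m (le_trans (le_max_right _ _) hm) H
  have G := hg m H
  have G' := hg' m H
  have hM : (1/2:ℝ) ≤ (m:ℝ) + 1/2 := by linarith [Nat.cast_nonneg (α := ℝ) m]
  have hM0 : (0:ℝ) < (m:ℝ) + 1/2 := by linarith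
  set M := (m:ℝ) + 1/2
  have hCg := mul_nonneg hC G
  have hCg' := mul_nonneg hC' G'
  constructor
  · have e : u m H * u' m H - v m H * v' m H = (u m H - v m H) * (u' m H - v' m H)
      + (u m H - v m H) * v' m H + v m H * (u' m H - v' m H) := by ring
    rw [e]
    calc _ ≤ |u m H - v m H| * |u' m H - v' m H| + |u m H - v m H| * |v' m H| +
        |v m H| * |u' m H - v' m H| := by
          refine (abs_add_le _ _).trans ?_
          rw [← abs_mul, ← abs_mul, ← abs_mul]
          gcongr
          exact abs_add_le _ _
      _ ≤ (C / M * g m H) * (C' / M * g' m H) + (C / M * g m H) * (C' * g' m H)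
          + (C * g m H) * (C' / M * g' m H) := by gcongr
      _ = (C * g m H) * (C' * g' m H) / M * (1 / M + 2) := by field_simp; ring
      _ ≤ (C * g m H) * (C' * g' m H) / M * (2 + 2) := by
          gcongr
          rw [div_le_iff₀ hM0]; linarith
      _ = _ := by field_simp; ring
  · rw [abs_mul]
    calc _ ≤ (C * g m H) * (C' * g' m H) := by gcongr
      _ ≤ _ := by nlinarith [mul_nonneg hCg hCg']

lemma Cls.add {g u v u' v' : ℕ → ℕ → ℝ} (h : Cls g u v) (h' : Cls g u' v') :
    Cls g (fun m H => u m H + u' m H) (fun m H => v m H + v' m H) := by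
  obtain ⟨hg, C, m0, hC, h⟩ := h
  obtain ⟨_, C', m0', hC', h'⟩ := h'
  refine ⟨hg, C + C', max m0 m0', by positivity, fun m hm H => ?_⟩
  obtain ⟨a1, a2⟩ := h m (le_trans (le_max_left _ _) hm) H
  obtain ⟨b1, b2⟩ := h' m (le_trans (le_max_right _ _) hm) H
  constructor
  · rw [add_sub_add_comm]
    refine (abs_add_le _ _).trans ((add_le_add a1 b1).trans (le_of_eq ?_)); ring
  · refine (abs_add_le _ _).trans ((add_le_add a2 b2).trans (le_of_eq ?_)); ring

lemma Cls.weak {g g' u v : ℕ → ℕ → ℝ} (h : Cls g u v) (c : ℝ) (hc : 0 ≤ c)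
    (hg' : ∀ m H, 0 ≤ g' m H) (hh : ∀ m H, g m H ≤ c * g' m H) : Cls g' u v := by
  obtain ⟨hg, C, m0, hC, h⟩ := h
  refine ⟨hg', C * c, m0, by positivity, fun m hm H => ?_⟩
  obtain ⟨a1, a2⟩ := h m hm H
  constructor
  · refine a1.trans ?_
    calc _ ≤ C / ((m:ℝ)+1/2) * (c * g' m H) := by gcongr; exact hh _ _
      _ = _ := by ring
  · refine a2.trans ?_
    calc _ ≤ C * (c * g' m H) := by gcongr; exact hh _ _
      _ = _ := by ring

lemma Cls.const (c : ℝ) : Cls (fun _ _ => 1) (fun _ _ => c) (fun _ _ => c) :=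
  ⟨fun _ _ => zero_le_one, |c|, 0, abs_nonneg _, fun m _ H => by
    simp; positivity⟩

lemma Cls.smul {g u v : ℕ → ℕ → ℝ} (c : ℝ) (h : Cls g u v) :
    Cls g (fun m H => c * u m H) (fun m H => c * v m H) := by
  have := (Cls.const c).mul h
  simpa using this

lemma Cls.sub {g u v u' v' : ℕ → ℕ → ℝ} (h : Cls g u v) (h' : Cls g u' v') :
    Cls g (fun m H => u m H - u' m H) (fun m H => v m H - v' m H) := by
  have := h.add (h'.smul (-1))
  simpa [sub_eq_add_neg] using this

lemma Cls.zero {g : ℕ → ℕ → ℝ} (hg : ∀ m H, 0 ≤ g m H) : Cls g (fun _ _ => 0) (fun _ _ => 0) :=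
  ⟨hg, 0, 0, le_rfl, fun m _ H => by simp⟩

lemma Cls.sum {ι : Type*} {g : ℕ → ℕ → ℝ} (hg : ∀ m H, 0 ≤ g m H) (s : Finset ι)
    (u v : ι → ℕ → ℕ → ℝ) (h : ∀ i ∈ s, Cls g (u i) (v i)) :
    Cls g (fun m H => ∑ i ∈ s, u i m H) (fun m H => ∑ i ∈ s, v i m H) := by
  classical
  induction s using Finset.induction_on with
  | empty => simpa using Cls.zero hg
  | insert a s ha ih =>
    simp only [Finset.sum_insert ha]
    exact (h a (by simp)).add (ih fun i hi => h i (by simp [hi]))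

lemma Cls.prod {ι : Type*} (s : Finset ι)
    (u v : ι → ℕ → ℕ → ℝ) (h : ∀ i ∈ s, Cls (fun _ _ => 1) (u i) (v i)) :
    Cls (fun _ _ => 1) (fun m H => ∏ i ∈ s, u i m H) (fun m H => ∏ i ∈ s, v i m H) := by
  classical
  induction s using Finset.induction_on with
  | empty => simpa using Cls.const 1
  | insert a s ha ih =>
    simp only [Finset.prod_insert ha]
    simpa using (h a (by simp)).mul (ih fun i hi => h i (by simp [hi]))

lemma Cls.prod_sub {ι : Type*} {g : ℕ → ℕ → ℝ} (hg : ∀ m H, g m H ≤ 1) (hg0 : ∀ m H, 0 ≤ g m H)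
    (s : Finset ι)
    (u v u' v' : ι → ℕ → ℕ → ℝ) (h : ∀ i ∈ s, Cls (fun _ _ => 1) (u i) (v i))
    (h' : ∀ i ∈ s, Cls g (u' i) (v' i)) :
    Cls g (fun m H => ∏ i ∈ s, u i m H - ∏ i ∈ s, (u i m H - u' i m H))
      (fun m H => ∏ i ∈ s, v i m H - ∏ i ∈ s, (v i m H - v' i m H)) := by
  classical
  induction s using Finset.induction_on with
  | empty => simpa using Cls.zero hg0
  | insert a s ha ih =>
    simp only [Finset.prod_insert ha]
    have i1 := ih (fun i hi => h i (by simp [hi])) (fun i hi => h' i (by simp [hi]))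
    have i2 := (h a (by simp)).mul i1
    have i3 := (h' a (by simp)).mul (Cls.prod s (fun i m H => u i m H - u' i m H)
      (fun i m H => v i m H - v' i m H) fun i hi => (h i (by simp [hi])).sub
        ((h' i (by simp [hi])).weak 1 zero_le_one (fun _ _ => zero_le_one) (by simpa using hg)))
    simp only [one_mul, mul_one] at i2 i3
    convert i2.add i3 using 3 <;> ring

lemma Cls.inv {u : ℕ → ℕ → ℝ} {c : ℝ} (hc : c ≠ 0) (h : Cls (fun _ _ => 1) u (fun _ _ => c)) :
    Cls (fun _ _ => 1) (fun m H => (u m H)⁻¹) (fun _ _ => c⁻¹) ∧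
    ∃ m0 : ℕ, ∀ m ≥ m0, ∀ H, u m H ≠ 0 := by
  obtain ⟨hg, C, m0, hC, h⟩ := h
  obtain ⟨m1, hm1⟩ := exists_nat_ge (2 * C / |c|)
  have hc' : 0 < |c| := abs_pos.2 hc
  have key : ∀ m ≥ max m0 m1, ∀ H, |c|/2 ≤ |u m H| := by
    intro m hm H
    obtain ⟨a1, _⟩ := h m (le_trans (le_max_left _ _) hm) H
    have hm' : (m1:ℝ) ≤ m := by exact_mod_cast (le_trans (le_max_right _ _) hm)
    have hM : 2 * C / |c| ≤ (m:ℝ) + 1/2 := by linarith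
    have : C / ((m:ℝ)+1/2) ≤ |c|/2 := by
      rw [div_le_iff₀ (by positivity)]
      rw [div_le_iff₀ hc'] at hM
      nlinarith
    have h3 := abs_sub_abs_le_abs_sub c (u m H)
    rw [abs_sub_comm] at h3
    linarith
  constructor
  · refine ⟨hg, 2 * C / |c|^2 + |c|⁻¹, max m0 m1, by positivity, fun m hm H => ?_⟩
    have k := key m hm H
    obtain ⟨a1, _⟩ := h m (le_trans (le_max_left _ _) hm) H
    have hu : 0 < |u m H| := by linarith
    have hM : 0 < (m:ℝ) + 1/2 := by positivity
    constructor
    · rw [inv_sub_inv (abs_pos.1 hu) hc, abs_div, abs_mul, abs_sub_comm]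
      calc _ ≤ (C / ((m:ℝ)+1/2) * 1) / (|c|/2 * |c|) := by gcongr
        _ = (2 * C / |c|^2) / ((m:ℝ)+1/2) * 1 := by field_simp
        _ ≤ _ := by
          gcongr
          linarith [inv_pos.2 hc']
    · rw [abs_inv, mul_one]
      have : 0 ≤ 2 * C / |c|^2 := by positivity
      linarith
  · exact ⟨max m0 m1, fun m hm H => abs_pos.1 (by linarith [key m hm H])⟩

lemma Cls_coef (k : ℕ) : Cls (fun _ _ => 1)
    (fun m _ => 4 * ((m:ℝ)+1/2) / (2 * ((m:ℝ)+1/2) - 1 - k)) (fun _ _ => 2) := by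
  refine ⟨fun _ _ => zero_le_one, 2 * (k + 1), k + 1, by positivity, fun m hm H => ?_⟩
  have hm' : (k:ℝ) + 1 ≤ m := by exact_mod_cast hm
  have hk : (0:ℝ) ≤ k := by positivity
  set M := (m:ℝ) + 1/2 with hM
  have h1 : M ≤ 2 * M - 1 - k := by linarith
  have h0 : 0 < M := by positivity
  constructor
  · have : 4 * M / (2 * M - 1 - k) - 2 = 2 * (k+1) / (2 * M - 1 - k) := by
      have h2 : 2 * M - 1 - k ≠ 0 := by linarith
      rw [eq_div_iff h2, sub_mul, div_mul_cancel₀ _ h2]; ring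
    rw [this, abs_of_nonneg (div_nonneg (by positivity) (by linarith)), mul_one]
    gcongr
  · simp

lemma Cls_rr (x : ℕ → ℕ → ℝ) (hx : ∀ m H, 0 ≤ x m H) (k : ℕ) :
    Cls (fun m H => (1 + x m H)^k) (fun m H => rr ((m:ℝ)+1/2) k (x m H))
      (fun m H => hermiteH k (x m H)) := by
  have hg : ∀ k m H, 0 ≤ (1 + x m H)^k := fun k m H => by have := hx m H; positivity
  have hX : Cls (fun m H => 1 + x m H) x x := by
    refine ⟨fun m H => by linarith [hx m H], 1, 0, zero_le_one, fun m _ H => ?_⟩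
    have := hx m H
    refine ⟨by rw [sub_self, abs_zero]; positivity, ?_⟩
    rw [abs_of_nonneg this]; linarith
  induction k using Nat.strong_induction_on with
  | _ k ih =>
    match k, ih with
    | 0, _ =>
      simp only [rr, hermiteH_zero, pow_zero]
      exact Cls.const 1
    | 1, _ =>
      simp only [rr, hermiteH_one, pow_one]
      have := (Cls_coef 0).mul hX
      simpa using this
    | k+2, ih =>
      simp only [rr, hermiteH_rec]
      have h1 := hX.mul (ih (k+1) (by omega))
      have h2 := ((ih k (by omega)).smul ((k:ℝ)+1)).weak (g' := fun m H => (1 + x m H)^(k+2)) 1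
        zero_le_one (hg _) (fun m H => by
          rw [one_mul]; exact pow_le_pow_right₀ (by linarith [hx m H]) (by omega))
      have h1' := h1.weak (g' := fun m H => (1 + x m H)^(k+2)) 1 zero_le_one (hg _)
        (fun m H => by rw [one_mul]; exact le_of_eq (by ring))
      have h3 := (Cls_coef (k+1)).mul (h1'.sub h2)
      simpa using h3

noncomputable def xx (m H : ℕ) : ℝ := H / √((m:ℝ)+1/2)
lemma xx_nonneg (m H : ℕ) : 0 ≤ xx m H := by unfold xx; positivity

lemma Cls_bet : Cls (fun m H => (1 + xx m H)^4 * Real.exp (-(xx m H)^2)) bet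
    (fun m H => Real.exp (-(xx m H)^2)) := by
  have hx := xx_nonneg
  refine ⟨fun m H => by have := hx m H; positivity, 2, 0, zero_le_two, fun m _ H => ?_⟩
  have hM : 0 < (m:ℝ) + 1/2 := by positivity
  have e1 : (H:ℝ)^2/((m:ℝ)+1/2) = (xx m H)^2 := by
    unfold xx; rw [div_pow, Real.sq_sqrt hM.le]
  have e2 : 2 * (H:ℝ)^4/((m:ℝ)+1/2)^3 = 2 / ((m:ℝ)+1/2) * (xx m H)^4 := by
    rw [show (xx m H)^4 = ((xx m H)^2)^2 by ring, ← e1]; field_simp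
  obtain ⟨b1, b2⟩ := bet_bounds m H
  rw [e1] at b1 b2
  rw [e2] at b2
  have hE := Real.exp_pos (-(xx m H)^2)
  have h4 : (xx m H)^4 ≤ (1 + xx m H)^4 := by
    have := hx m H
    gcongr; linarith
  constructor
  · rw [abs_sub_comm, abs_of_nonneg (by linarith)]
    calc _ ≤ 2 / ((m:ℝ)+1/2) * ((xx m H)^4 * Real.exp (-(xx m H)^2)) := by linarith
      _ ≤ _ := by
        apply mul_le_mul_of_nonneg_left _ (by positivity)
        exact mul_le_mul_of_nonneg_right h4 hE.le
  · rw [abs_of_pos hE]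
    have : 1 ≤ (1 + xx m H)^4 := one_le_pow₀ (by linarith [hx m H])
    nlinarith

lemma poly_exp (K : ℕ) : ∃ C : ℝ, 0 ≤ C ∧ ∀ x : ℝ, 0 ≤ x → (1 + x)^K * Real.exp (-x^2) ≤ C := by
  refine ⟨K.factorial * Real.exp 2, by positivity, fun x hx => ?_⟩
  have h1 := Real.pow_div_factorial_le_exp (1 + x) (by linarith) K
  rw [div_le_iff₀ (by positivity)] at h1
  calc _ ≤ (Real.exp (1+x) * K.factorial) * Real.exp (1 - 2 * x) := by
        gcongr
        nlinarith [sq_nonneg (x-1)]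
    _ = K.factorial * (Real.exp (1 + x) * Real.exp (1 - 2 * x)) := by ring
    _ ≤ _ := by
        rw [← Real.exp_add]
        gcongr
        linarith

lemma poly_exp2 (K : ℕ) : ∃ C : ℝ, 0 ≤ C ∧ ∀ x : ℝ, 0 ≤ x →
    (1 + x)^K * Real.exp (-x^2) ≤ C * (1 / (1 + x)^2) := by
  obtain ⟨C, hC, h⟩ := poly_exp (K+2)
  refine ⟨C, hC, fun x hx => ?_⟩
  rw [mul_one_div, le_div_iff₀ (by positivity)]
  calc _ = (1 + x)^(K+2) * Real.exp (-x^2) := by ring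
    _ ≤ C := h x hx

noncomputable def g1 (m H : ℕ) : ℝ := 1 / (1 + xx m H)^2
lemma g1_nonneg (m H : ℕ) : 0 ≤ g1 m H := by have := xx_nonneg m H; unfold g1; positivity
lemma g1_le (m H : ℕ) : g1 m H ≤ 1 := by
  have := xx_nonneg m H; unfold g1; rw [div_le_one (by positivity)]
  exact one_le_pow₀ (by linarith)

noncomputable def PP (p : ℕ) (x : ℝ) : Matrix (Fin p) (Fin p) ℝ :=
  Matrix.of fun i j => hermiteH ((i : ℕ)+(j : ℕ)) x * Real.exp (-x^2)

lemma Cls_JJ (p : ℕ) (a b : Fin p) : Cls g1 (fun m H => JJ p m H a b)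
    (fun m H => PP p (xx m H) a b) := by
  have h := (Cls_rr xx xx_nonneg (a+b)).mul Cls_bet
  obtain ⟨C, hC, h2⟩ := poly_exp2 ((a:ℕ)+b+4)
  have h3 := h.weak (g' := g1) C hC g1_nonneg (fun m H => by
    refine le_trans (le_of_eq ?_) (h2 _ (xx_nonneg m H))
    ring)
  exact h3

lemma Cls_MM (p : ℕ) (a b : Fin p) : Cls (fun _ _ => 1) (fun m _ => MM p m a b)
    (fun _ _ => MI p a b) := by
  have h := Cls_rr (fun _ _ => 0) (fun _ _ => le_rfl) (a+b)
  simp only [add_zero, one_pow] at h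
  exact h.smul _

lemma Cls_detMM (p : ℕ) : Cls (fun _ _ => 1) (fun m _ => (MM p m).det) (fun _ _ => (MI p).det) := by
  simp only [Matrix.det_apply']
  refine Cls.sum (fun _ _ => zero_le_one) _ _ _ fun σ _ => Cls.smul _ ?_
  exact Cls.prod _ (fun i m _ => MM p m (σ i) i) (fun i _ _ => MI p (σ i) i) fun i _ => Cls_MM _ _ _

lemma Cls_del (p : ℕ) : Cls g1 (fun m H => (MM p m).det - (MM p m - JJ p m H).det)
    (fun m H => (MI p).det - (MI p - PP p (xx m H)).det) := by
  simp only [Matrix.det_apply', ← Finset.sum_sub_distrib, ← mul_sub]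
  refine Cls.sum g1_nonneg _ _ _ fun σ _ => Cls.smul _ ?_
  exact Cls.prod_sub g1_le g1_nonneg _ (fun i m _ => MM p m (σ i) i) (fun i _ _ => MI p (σ i) i)
    (fun i m H => JJ p m H (σ i) i) (fun i m H => PP p (xx m H) (σ i) i)
    (fun i _ => Cls_MM _ _ _) (fun i _ => Cls_JJ _ _ _)

lemma kappa_eq (p : ℕ) (x : ℝ) : kappa p x = ((MI p).det - (MI p - PP p x).det) * (MI p).det⁻¹ := by
  have h := (MI_det_pos p).ne'
  rw [sub_mul, mul_inv_cancel₀ h, kappa, MI_det, mul_inv, div_eq_mul_inv, mul_comm]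
  congr 2

lemma kap_main (p : ℕ) : ∃ C : ℝ, ∃ m0 : ℕ, 0 ≤ C ∧ ∀ m : ℕ, m0 ≤ m →
    (MM p m).det ≠ 0 ∧ ∀ H : ℕ, |kap p m H - kappa p (xx m H)| ≤ C / ((m:ℝ)+1/2) * g1 m H := by
  obtain ⟨h1, m1, h2⟩ := Cls.inv (MI_det_pos p).ne' (Cls_detMM p)
  have h3 := (Cls_del p).mul h1
  obtain ⟨_, C, m0, hC, h⟩ := h3
  refine ⟨C, max m0 m1, hC, fun m hm => ⟨h2 m (le_trans (le_max_right _ _) hm) 0, fun H => ?_⟩⟩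
  have := (h m (le_trans (le_max_left _ _) hm) H).1
  simp only [mul_one] at this
  rw [kappa_eq, kap, div_eq_mul_inv]
  exact this

inductive Nice : (ℝ → ℝ) → Prop
  | const (c : ℝ) : Nice (fun _ => c)
  | ident : Nice (fun x => x)
  | ex : Nice (fun x => Real.exp (-x^2))
  | add (f g : ℝ → ℝ) : Nice f → Nice g → Nice (fun x => f x + g x)
  | mul (f g : ℝ → ℝ) : Nice f → Nice g → Nice (fun x => f x * g x)

lemma hasDeriv_ex (x : ℝ) : HasDerivAt (fun x : ℝ => Real.exp (-x^2)) (-2 * (x * Real.exp (-x^2))) x := by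
  have := ((hasDerivAt_pow 2 x).neg).exp
  refine HasDerivAt.congr_deriv (f := fun x : ℝ => Real.exp (-x^2)) this ?_
  change Real.exp (-x^2) * _ = _
  push_cast; ring

lemma Nice.deriv {f : ℝ → ℝ} (h : Nice f) : ∃ f', Nice f' ∧ ∀ x, HasDerivAt f (f' x) x := by
  induction h with
  | const c => exact ⟨_, Nice.const 0, fun x => hasDerivAt_const x c⟩
  | ident => exact ⟨_, Nice.const 1, fun x => hasDerivAt_id x⟩
  | ex => exact ⟨_, Nice.mul _ _ (Nice.const (-2)) (Nice.mul _ _ Nice.ident Nice.ex), hasDeriv_ex⟩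
  | add f g _ _ hf hg =>
    obtain ⟨f', a, b⟩ := hf
    obtain ⟨g', c, d⟩ := hg
    exact ⟨_, Nice.add _ _ a c, fun x => (b x).add (d x)⟩
  | mul f g hf0 hg0 hf hg =>
    obtain ⟨f', a, b⟩ := hf
    obtain ⟨g', c, d⟩ := hg
    exact ⟨_, Nice.add _ _ (Nice.mul _ _ a hg0) (Nice.mul _ _ hf0 c), fun x => (b x).mul (d x)⟩

lemma Nice.bound {f : ℝ → ℝ} (h : Nice f) : ∃ C : ℝ, ∃ k : ℕ, 0 ≤ C ∧ ∀ x, 0 ≤ x →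
    |f x| ≤ C * (1 + x)^k := by
  induction h with
  | const c => exact ⟨|c|, 0, abs_nonneg _, fun x _ => by simp⟩
  | ident => exact ⟨1, 1, zero_le_one, fun x hx => by rw [abs_of_nonneg hx]; simp⟩
  | ex => exact ⟨1, 0, zero_le_one, fun x hx => by
      rw [abs_of_pos (Real.exp_pos _)]; simp; positivity⟩
  | add f g _ _ hf hg =>
    obtain ⟨C, k, hC, h⟩ := hf
    obtain ⟨D, l, hD, h'⟩ := hg
    refine ⟨C + D, k + l, by positivity, fun x hx => ?_⟩
    have h1 : (1:ℝ) ≤ 1 + x := by linarith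
    calc _ ≤ |f x| + |g x| := abs_add_le _ _
      _ ≤ C * (1+x)^k + D * (1 + x)^l := add_le_add (h x hx) (h' x hx)
      _ ≤ C * (1+x)^(k+l) + D * (1 + x)^(k+l) := by gcongr <;> first | exact h1 | omega
      _ = _ := by ring
  | mul f g hf0 hg0 hf hg =>
    obtain ⟨C, k, hC, h⟩ := hf
    obtain ⟨D, l, hD, h'⟩ := hg
    refine ⟨C * D, k + l, by positivity, fun x hx => ?_⟩
    rw [abs_mul]
    calc _ ≤ (C * (1+x)^k) * (D * (1 + x)^l) := by
          have := h x hx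
          have := h' x hx
          gcongr
      _ = _ := by ring

def Dec (f : ℝ → ℝ) : Prop := ∃ g, Nice g ∧ f = fun x => Real.exp (-x^2) * g x

lemma Dec.nice {f : ℝ → ℝ} (h : Dec f) : Nice f := by
  obtain ⟨g, hg, rfl⟩ := h
  exact Nice.mul _ _ Nice.ex hg

lemma Dec.add {f g : ℝ → ℝ} (h : Dec f) (h' : Dec g) : Dec (fun x => f x + g x) := by
  obtain ⟨g, hg, rfl⟩ := h
  obtain ⟨g', hg', rfl⟩ := h'
  exact ⟨_, Nice.add _ _ hg hg', by ext x; ring⟩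

lemma Dec.mul {f g : ℝ → ℝ} (h : Nice f) (h' : Dec g) : Dec (fun x => f x * g x) := by
  obtain ⟨g', hg', rfl⟩ := h'
  exact ⟨_, Nice.mul _ _ h hg', by ext x; ring⟩

lemma Dec.zero : Dec (fun _ => 0) := ⟨_, Nice.const 0, by simp⟩

lemma Dec.deriv {f : ℝ → ℝ} (h : Dec f) : ∃ f', Dec f' ∧ ∀ x, HasDerivAt f (f' x) x := by
  obtain ⟨g, hg, rfl⟩ := h
  obtain ⟨g', a, b⟩ := hg.deriv
  refine ⟨fun x => (-2 * (x * Real.exp (-x^2))) * g x + Real.exp (-x^2) * g' x, ?_,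
    fun x => (hasDeriv_ex x).mul (b x)⟩
  exact ⟨_, Nice.add _ _ (Nice.mul _ _ (Nice.mul _ _ (Nice.const (-2)) Nice.ident) hg) a, by
    ext x; ring⟩

lemma Dec.bound {f : ℝ → ℝ} (h : Dec f) : ∃ C : ℝ, 0 ≤ C ∧ ∀ x, 0 ≤ x →
    |f x| ≤ C / (1 + x)^2 := by
  obtain ⟨g, hg, rfl⟩ := h
  obtain ⟨C, k, hC, h⟩ := hg.bound
  obtain ⟨D, hD, h'⟩ := poly_exp2 k
  refine ⟨C * D, by positivity, fun x hx => ?_⟩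
  rw [abs_mul, abs_of_pos (Real.exp_pos _)]
  calc _ ≤ Real.exp (-x^2) * (C * (1 + x)^k) := by
        have := h x hx
        gcongr
    _ = C * ((1 + x)^k * Real.exp (-x^2)) := by ring
    _ ≤ C * (D * (1 / (1 + x)^2)) := by
        have := h' x hx
        gcongr
    _ = _ := by ring

lemma Nice.sub {f g : ℝ → ℝ} (h : Nice f) (h' : Nice g) : Nice (fun x => f x - g x) := by
  have := Nice.add _ _ h (Nice.mul _ _ (Nice.const (-1)) h')
  simpa [sub_eq_add_neg] using this

lemma Nice.prod {ι : Type*} (s : Finset ι) (f : ι → ℝ → ℝ) (h : ∀ i ∈ s, Nice (f i)) :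
    Nice (fun x => ∏ i ∈ s, f i x) := by
  classical
  induction s using Finset.induction_on with
  | empty => simpa using Nice.const 1
  | insert a s ha ih =>
    simp only [Finset.prod_insert ha]
    exact Nice.mul _ _ (h a (by simp)) (ih fun i hi => h i (by simp [hi]))

lemma Dec.sum {ι : Type*} (s : Finset ι) (f : ι → ℝ → ℝ) (h : ∀ i ∈ s, Dec (f i)) :
    Dec (fun x => ∑ i ∈ s, f i x) := by
  classical
  induction s using Finset.induction_on with
  | empty => simpa using Dec.zero
  | insert a s ha ih =>
    simp only [Finset.sum_insert ha]
    exact Dec.add (h a (by simp)) (ih fun i hi => h i (by simp [hi]))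

lemma Dec.prod_sub {ι : Type*} (s : Finset ι) (f g : ι → ℝ → ℝ) (h : ∀ i ∈ s, Nice (f i))
    (h' : ∀ i ∈ s, Dec (g i)) :
    Dec (fun x => ∏ i ∈ s, f i x - ∏ i ∈ s, (f i x - g i x)) := by
  classical
  induction s using Finset.induction_on with
  | empty => simpa using Dec.zero
  | insert a s ha ih =>
    simp only [Finset.prod_insert ha]
    have i1 := Dec.mul (h a (by simp)) (ih (fun i hi => h i (by simp [hi])) (fun i hi => h' i (by simp [hi])))
    have i2 := Dec.mul (Nice.prod s (fun i x => f i x - g i x) (fun i hi =>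
      (h i (by simp [hi])).sub (h' i (by simp [hi])).nice)) (h' a (by simp))
    convert i1.add i2 using 2; ring

lemma nice_hermite (k : ℕ) : Nice (hermiteH k) := by
  induction k using Nat.strong_induction_on with
  | _ k ih =>
    match k, ih with
    | 0, _ => rw [show hermiteH 0 = fun _ => 1 from funext hermiteH_zero]; exact Nice.const 1
    | 1, _ => rw [show hermiteH 1 = fun x => 2 * x from funext hermiteH_one]
              exact Nice.mul _ _ (Nice.const 2) Nice.ident
    | k+2, ih =>
      rw [show hermiteH (k+2) = _ from funext (hermiteH_rec k)]
      exact Nice.mul _ _ (Nice.const 2) ((Nice.mul _ _ Nice.ident (ih (k+1) (by omega))).sub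
        (Nice.mul _ _ (Nice.const _) (ih k (by omega))))

lemma dec_kappa (p : ℕ) : Dec (kappa p) := by
  rw [show kappa p = _ from funext (kappa_eq p)]
  simp only [mul_comm _ ((MI p).det⁻¹)]
  apply Dec.mul (Nice.const _)
  simp only [Matrix.det_apply', ← Finset.sum_sub_distrib, ← mul_sub]
  refine Dec.sum _ _ fun σ _ => Dec.mul (Nice.const _) ?_
  exact Dec.prod_sub _ (fun i _ => MI p (σ i) i) (fun i x => PP p x (σ i) i)
    (fun i _ => Nice.const _) (fun i _ => ⟨_, nice_hermite (σ i + i), by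
      ext x; simp only [PP, Matrix.of_apply]; ring⟩)

lemma kappa_zero {p : ℕ} (hp : 0 < p) : kappa p 0 = 1 := by
  rw [kappa_eq, Matrix.det_eq_zero_of_row_eq_zero (A := MI p - PP p 0) ⟨0, hp⟩, sub_zero,
    mul_inv_cancel₀ (MI_det_pos p).ne']
  intro j
  simp [MI, PP]

lemma kappa_reg {p : ℕ} : ∃ f' f'' : ℝ → ℝ, ∃ C : ℝ, 0 ≤ C ∧
    (∀ x, HasDerivAt (kappa p) (f' x) x) ∧ (∀ x, HasDerivAt f' (f'' x) x) ∧
    ∀ x, 0 ≤ x → |kappa p x| ≤ C / (1 + x)^2 ∧ |f' x| ≤ C / (1 + x)^2 ∧ |f'' x| ≤ C / (1 + x)^2 := by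
  have h0 := dec_kappa p
  obtain ⟨f', h1, d1⟩ := h0.deriv
  obtain ⟨f'', h2, d2⟩ := h1.deriv
  obtain ⟨C0, p0, b0⟩ := h0.bound
  obtain ⟨C1, p1, b1⟩ := h1.bound
  obtain ⟨C2, p2, b2⟩ := h2.bound
  refine ⟨f', f'', C0 + C1 + C2, by positivity, d1, d2, fun x hx => ⟨(b0 x hx).trans ?_,
    (b1 x hx).trans ?_, (b2 x hx).trans ?_⟩⟩ <;> gcongr <;> linarith

lemma trap (F f f' f'' : ℝ → ℝ) (a ε K : ℝ) (hε : 0 ≤ ε) (hF : ∀ x, HasDerivAt F (f x) x)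
    (hf : ∀ x, HasDerivAt f (f' x) x) (hf' : ∀ x, HasDerivAt f' (f'' x) x)
    (hK : ∀ x, a ≤ x → |f'' x| ≤ K) :
    |F (a + ε) - F a - ε * (f a + f (a+ε)) / 2| ≤ K * ε^3 := by
  have hK0 : 0 ≤ K := (abs_nonneg _).trans (hK a le_rfl)
  have lip : ∀ s t, a ≤ s → s ≤ t → |f' t - f' s| ≤ K * (t - s) := by
    intro s t h1 h2
    have := norm_image_sub_le_of_norm_deriv_le_segment' (f := f') (f' := f'') (C := K) (a := s) (b := t)
      (fun x _ => (hf' x).hasDerivWithinAt) (fun x hx => hK x (h1.trans hx.1)) t ⟨h2, le_rfl⟩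
    simpa using this
  have l2 : ∀ t, a ≤ t → t ≤ a + ε → |f t - f a - (t - a) * f' t| ≤ K * ε * ε := by
    intro t h1 h2
    have := norm_image_sub_le_of_norm_deriv_le_segment' (f := fun s => f s - s * f' t)
      (f' := fun s => f' s - 1 * f' t) (C := K * ε) (a := a) (b := t)
      (fun x _ => ((hf x).sub ((hasDerivAt_id x).mul_const _)).hasDerivWithinAt)
      (fun x hx => by
        rw [one_mul, Real.norm_eq_abs, abs_sub_comm]
        refine (lip x t hx.1 hx.2.le).trans ?_
        have := hx.1
        gcongr; linarith) t ⟨h1, le_rfl⟩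
    rw [Real.norm_eq_abs] at this
    have e : f t - t * f' t - (f a - a * f' t) = f t - f a - (t - a) * f' t := by ring
    rw [e] at this
    refine this.trans ?_
    gcongr; linarith
  have := norm_image_sub_le_of_norm_deriv_le_segment' (f := fun s => F s - (s - a) * (f a + f s) / 2)
      (f' := fun s => f s - (1 * (f a + f s) + (s - a) * f' s) / 2) (C := K * ε * ε)
      (a := a) (b := a + ε)
      (fun x _ => ((hF x).sub ((((hasDerivAt_id x).sub_const a).mul
        ((hf x).const_add (f a))).div_const 2)).hasDerivWithinAt)
      (fun x hx => by
        have := l2 x hx.1 hx.2.le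
        rw [Real.norm_eq_abs]
        have e : f x - (1 * (f a + f x) + (x - a) * f' x) / 2 = (f x - f a - (x - a) * f' x) / 2 := by
          ring
        rw [e, abs_div, abs_two]
        linarith [abs_nonneg (f x - f a - (x - a) * f' x)]) (a+ε) ⟨by linarith, le_rfl⟩
  rw [Real.norm_eq_abs] at this
  have e : F (a + ε) - (a + ε - a) * (f a + f (a + ε)) / 2 - (F a - (a - a) * (f a + f a) / 2) =
    F (a + ε) - F a - ε * (f a + f (a+ε)) / 2 := by ring
  rw [e] at this
  refine this.trans (le_of_eq ?_)
  ring

lemma sum_tail (ε : ℝ) (h0 : 0 < ε) (h1 : ε ≤ 1) (L : ℕ) :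
    ∑ k ∈ Finset.range L, ε / (1 + k * ε)^2 ≤ 2 := by
  have : ∀ L : ℕ, ∑ k ∈ Finset.range L, ε / (1 + k * ε)^2 ≤ 2 - 2 / (1 + L * ε) := by
    intro L
    induction L with
    | zero => simp
    | succ L ih =>
      rw [Finset.sum_range_succ]
      have : ε / (1 + L * ε)^2 ≤ 2 / (1 + L * ε) - 2 / (1 + (L+1:ℕ) * ε) := by
        push_cast
        have hL : (0:ℝ) ≤ L * ε := by positivity
        have e : 2 / (1 + L * ε) - 2 / (1 + (L+1) * ε) = 2 * ε / ((1 + L * ε) * (1 + (L+1) * ε)) := by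
          have h2 : 1 + (L+1) * ε ≠ 0 := by positivity
          have h3 : 1 + L * ε ≠ 0 := by positivity
          field_simp; ring
        rw [e, div_le_div_iff₀ (by positivity) (by positivity)]
        have : (1 + L * ε) * (1 + (L+1) * ε) ≤ 2 * (1 + L * ε)^2 := by nlinarith
        nlinarith
      linarith
  have h2 := this L
  have : 0 ≤ 2 / (1 + L * ε) := by positivity
  linarith

lemma eulerM (F f f' f'' : ℝ → ℝ) (C : ℝ) (hF : ∀ x, HasDerivAt F (f x) x)
    (hf : ∀ x, HasDerivAt f (f' x) x) (hf' : ∀ x, HasDerivAt f' (f'' x) x) (hC : 0 ≤ C)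
    (hK : ∀ x, 0 ≤ x → |f'' x| ≤ C / (1 + x)^2) (ε : ℝ) (h0 : 0 < ε) (h1 : ε ≤ 1) (L : ℕ) :
    |F (L * ε) - F 0 - ε * (∑ k ∈ Finset.range L, f ((k+1:ℕ) * ε) + f 0 / 2 - f (L * ε) / 2)|
      ≤ 2 * C * ε^2 := by
  have : ∀ L : ℕ, |F (L * ε) - F 0 - ε * (∑ k ∈ Finset.range L, f ((k+1:ℕ) * ε) + f 0 / 2 - f (L * ε) / 2)|
      ≤ C * ε^2 * ∑ k ∈ Finset.range L, ε / (1 + k * ε)^2 := by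
    intro L
    induction L with
    | zero => simp
    | succ L ih =>
      rw [Finset.sum_range_succ, Finset.sum_range_succ, mul_add]
      have t := trap F f f' f'' (L * ε) ε (C / (1 + L * ε)^2) h0.le hF hf hf' (fun x hx => by
        have hL : (0:ℝ) ≤ L * ε := by positivity
        refine (hK x (hL.trans hx)).trans ?_
        gcongr)
      have e : (L:ℝ) * ε + ε = (L+1:ℕ) * ε := by push_cast; ring
      rw [e] at t
      have e2 : C / (1 + L * ε)^2 * ε^3 = C * ε^2 * (ε / (1 + L * ε)^2) := by ring
      rw [e2] at t
      refine le_trans ?_ (add_le_add ih t)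
      refine le_trans (le_of_eq ?_) (abs_add_le _ _)
      congr 1; ring
  refine (this L).trans ?_
  have := sum_tail ε h0 h1 L
  calc _ ≤ C * ε^2 * 2 := by gcongr
    _ = _ := by ring

lemma integrable_aux (f : ℝ → ℝ) (hf : Continuous f) (C : ℝ)
    (hb : ∀ x, 0 ≤ x → |f x| ≤ C / (1 + x)^2) : IntegrableOn f (Set.Ioi 0) := by
  have h1 : IntegrableOn (fun x : ℝ => C * (1 + x^2)⁻¹) (Set.Ioi 0) :=
    (integrable_inv_one_add_sq.const_mul C).integrableOn
  have hC : 0 ≤ C := by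
    have := (abs_nonneg _).trans (hb 0 le_rfl)
    simpa using this
  refine Integrable.mono' h1 hf.aestronglyMeasurable ?_
  filter_upwards [ae_restrict_mem measurableSet_Ioi] with x hx
  rw [Set.mem_Ioi] at hx
  refine (hb x hx.le).trans ?_
  rw [div_eq_mul_inv]
  gcongr
  nlinarith

lemma finish (p : ℕ) (hp : 0 < p) : ∃ D : ℝ, ∃ n0 : ℕ, 0 ≤ D ∧ ∀ n : ℕ, n0 ≤ n →
    |heightMoment p n 1 -
      ((∫ h in Set.Ioi (0:ℝ), kappa p h) * √(((n + (p-1) : ℕ):ℝ)+1/2) + (p : ℝ) - 3/2)|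
        ≤ D * (√(((n + (p-1) : ℕ):ℝ)+1/2))⁻¹ := by
  obtain ⟨C1, m0, hC1, hkap⟩ := kap_main p
  obtain ⟨f', f'', C2, hC2, d1, d2, hb⟩ := kappa_reg (p := p)
  have hcont : Continuous (kappa p) := continuous_iff_continuousAt.2 fun x => (d1 x).continuousAt
  have hint := integrable_aux _ hcont C2 (fun x hx => (hb x hx).1)
  have hF : ∀ x, HasDerivAt (fun t => ∫ s in (0:ℝ)..t, kappa p s) (kappa p x) x := fun x =>
    (hcont.integral_hasStrictDerivAt 0 x).hasDerivAt
  have hk0 := kappa_zero hp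
  refine ⟨2 * C1 + 2 * C2 + (p:ℝ)^2 * C2, m0 + 1, by positivity, fun n hn => ?_⟩
  set m := n + (p-1) with hm
  set s := √((m:ℝ)+1/2) with hs
  have hm1 : (1:ℝ) ≤ m := by exact_mod_cast (show 1 ≤ m by omega)
  have hs1 : 1 ≤ s := by rw [hs, Real.one_le_sqrt]; linarith
  have hs0 : 0 < s := by linarith
  have hsq : s^2 = (m:ℝ) + 1/2 := Real.sq_sqrt (by positivity)
  set ε := s⁻¹ with hε
  have hε0 : 0 < ε := inv_pos.2 hs0
  have hε1 : ε ≤ 1 := inv_le_one_of_one_le₀ hs1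
  have hxx : ∀ H : ℕ, xx m H = H * ε := fun H => by rw [xx, ← hs, hε, div_eq_mul_inv]
  obtain ⟨hdet, hk⟩ := hkap m (by omega)
  have hk' : ∀ H : ℕ, |kap p m H - kappa p (H * ε)| ≤ C1 * ε * (ε / (1 + H * ε)^2) := by
    intro H
    have := hk H
    rw [g1, hxx, ← hsq] at this
    refine this.trans (le_of_eq ?_)
    rw [hε]; field_simp
  have hlip : ∀ x, 0 ≤ x → |kappa p x - 1| ≤ C2 * x := by
    intro x hx
    have := norm_image_sub_le_of_norm_deriv_le_segment' (f := kappa p) (f' := f') (C := C2)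
      (a := 0) (b := x) (fun y _ => (d1 y).hasDerivWithinAt) (fun y hy => by
        refine (hb y hy.1).2.1.trans ?_
        apply div_le_self hC2
        exact one_le_pow₀ (by linarith [hy.1])) x ⟨hx, le_rfl⟩
    simpa [hk0] using this
  have key : ∀ L : ℕ, 2 * n + 2 * p ≤ L →
      |heightMoment p n 1 - ((∫ t in (0:ℝ)..(L * ε), kappa p t) * s + (p:ℝ) - 3/2
        + kappa p (L * ε) / 2)| ≤ (2 * C1 + 2 * C2 + (p:ℝ)^2 * C2) * ε := by
    intro L hL
    have a1 := expect_kap hp n hdet L hL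
    have a2 : |∑ H ∈ Finset.Icc p L, kap p m H - ∑ H ∈ Finset.Icc p L, kappa p (H * ε)|
        ≤ 2 * C1 * ε := by
      rw [← Finset.sum_sub_distrib]
      calc _ ≤ ∑ H ∈ Finset.Icc p L, |kap p m H - kappa p (H * ε)| := Finset.abs_sum_le_sum_abs _ _
        _ ≤ ∑ H ∈ Finset.Icc p L, C1 * ε * (ε / (1 + H * ε)^2) := Finset.sum_le_sum fun H _ => hk' H
        _ ≤ ∑ H ∈ Finset.range (L+1), C1 * ε * (ε / (1 + H * ε)^2) := by
          apply Finset.sum_le_sum_of_subset_of_nonneg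
          · intro H hH; simp at hH ⊢; omega
          · intros; positivity
        _ = C1 * ε * ∑ H ∈ Finset.range (L+1), (ε / (1 + H * ε)^2) := by rw [Finset.mul_sum]
        _ ≤ C1 * ε * 2 := by gcongr; exact sum_tail ε hε0 hε1 _
        _ = _ := by ring
    have a3 : ∑ k ∈ Finset.range L, kappa p ((k+1:ℕ) * ε) =
        ∑ k ∈ Finset.range (p-1), kappa p ((k+1:ℕ) * ε) +
          ∑ H ∈ Finset.Icc p L, kappa p (H * ε) := by
      rw [← Finset.sum_range_add_sum_Ico _ (show p - 1 ≤ L by omega)]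
      congr 1
      rw [Finset.sum_Ico_add' (fun k : ℕ => kappa p (k * ε)) (p-1) L 1,
        show p - 1 + 1 = p by omega]
      rfl
    have a4 : |∑ k ∈ Finset.range (p-1), kappa p ((k+1:ℕ) * ε) - ((p:ℝ) - 1)|
        ≤ (p:ℝ)^2 * C2 * ε := by
      have e : (p:ℝ) - 1 = ∑ k ∈ Finset.range (p-1), (1:ℝ) := by
        simp [Nat.cast_sub (show 1 ≤ p from hp)]
      rw [e, ← Finset.sum_sub_distrib]
      calc _ ≤ ∑ k ∈ Finset.range (p-1), |kappa p ((k+1:ℕ) * ε) - 1| :=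
            Finset.abs_sum_le_sum_abs _ _
        _ ≤ ∑ k ∈ Finset.range (p-1), C2 * (p * ε) := by
            refine Finset.sum_le_sum fun k hk => (hlip _ (by positivity)).trans ?_
            have : ((k+1:ℕ):ℝ) ≤ p := by
              have := Finset.mem_range.1 hk
              exact_mod_cast (by omega)
            gcongr
        _ = ((p-1:ℕ):ℝ) * (C2 * (p * ε)) := by simp
        _ ≤ (p:ℝ) * (C2 * (p * ε)) := by
            have : ((p-1:ℕ):ℝ) ≤ p := by exact_mod_cast (by omega)
            gcongr
        _ = _ := by ring
    have a5 := eulerM _ _ f' f'' C2 hF d1 d2 hC2 (fun x hx => (hb x hx).2.2) ε hε0 hε1 L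
    simp only [intervalIntegral.integral_same, sub_zero, hk0] at a5
    rw [a3] at a5
    have hse : s * ε = 1 := mul_inv_cancel₀ hs0.ne'
    generalize (∫ t in (0:ℝ)..(L * ε), kappa p t) = Fv at *
    generalize ∑ H ∈ Finset.Icc p L, kappa p (H * ε) = S1 at *
    generalize ∑ k ∈ Finset.range (p-1), kappa p ((k+1:ℕ) * ε) = S2 at *
    generalize ∑ H ∈ Finset.Icc p L, kap p m H = S0 at *
    generalize kappa p (L * ε) = v at *
    have a6 : |Fv * s - (S2 + S1 + 1 / 2 - v / 2)| ≤ 2 * C2 * ε := by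
      have e : Fv * s - (S2 + S1 + 1 / 2 - v / 2) = s * (Fv - ε * (S2 + S1 + 1/2 - v/2)) := by
        linear_combination (S2 + S1 + 1 / 2 - v / 2) * hse
      rw [e, abs_mul, abs_of_pos hs0]
      calc _ ≤ s * (2 * C2 * ε^2) := by gcongr
        _ = (s * ε) * (2 * C2 * ε) := by ring
        _ = _ := by rw [hse, one_mul]
    rw [a1]
    rw [abs_le] at *
    constructor <;> nlinarith
  have t1 : Tendsto (fun L : ℕ => (L:ℝ) * ε) atTop atTop :=
    tendsto_natCast_atTop_atTop.atTop_mul_const hε0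
  have t2 : Tendsto (fun L : ℕ => ∫ t in (0:ℝ)..(L * ε), kappa p t) atTop
      (nhds (∫ h in Set.Ioi (0:ℝ), kappa p h)) :=
    intervalIntegral_tendsto_integral_Ioi 0 hint t1
  have t3 : Tendsto (fun L : ℕ => kappa p (L * ε)) atTop (nhds 0) := by
    have hz : Tendsto (fun x : ℝ => C2 / (1 + x)^2) atTop (nhds 0) := by
      apply Tendsto.div_atTop tendsto_const_nhds
      exact (tendsto_pow_atTop two_ne_zero).comp (tendsto_atTop_add_const_left _ _ tendsto_id)
    refine squeeze_zero_norm (fun L => ?_) (hz.comp t1)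
    exact (hb _ (by positivity)).1
  have t4 := ((((t2.mul_const s).add_const (p:ℝ)).sub_const (3/2)).add (t3.div_const 2)).const_sub
    (heightMoment p n 1) |>.abs
  simp only [zero_div, add_zero] at t4
  refine le_of_tendsto t4 ?_
  filter_upwards [eventually_ge_atTop (2 * n + 2 * p)] with L hL
  exact key L hL

lemma final15 (p : ℕ) (hp : 0 < p) :
    ∃ C : ℝ, ∃ n0 : ℕ, ∀ n : ℕ, n0 ≤ n →
      |heightMoment p n 1 -
          ((∫ h in Set.Ioi (0:ℝ), kappa p h) * Real.sqrt n + (p : ℝ) - 3/2)|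
        ≤ C * (Real.sqrt n)⁻¹ := by
  obtain ⟨D, n0, hD, h⟩ := finish p hp
  set I := ∫ h in Set.Ioi (0:ℝ), kappa p h
  refine ⟨D + |I| * p, n0 + 1, fun n hn => ?_⟩
  have h1 := h n (by omega)
  have hn0 : (0:ℝ) < n := by exact_mod_cast (show 0 < n by omega)
  set r := √(n:ℝ) with hr
  have hr0 : 0 < r := Real.sqrt_pos.2 hn0
  have hrq : r^2 = n := Real.sq_sqrt hn0.le
  set s := √(((n + (p-1) : ℕ):ℝ)+1/2) with hs
  have hsq : s^2 = (n:ℝ) + p - 1/2 := by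
    rw [hs, Real.sq_sqrt (by positivity)]
    push_cast [Nat.cast_sub (show 1 ≤ p from hp)]; ring
  have hp1 : (1:ℝ) ≤ p := by exact_mod_cast hp
  have hrs : r ≤ s := by
    apply Real.sqrt_le_sqrt
    push_cast [Nat.cast_sub (show 1 ≤ p from hp)]; linarith
  have hd : |s - r| ≤ p * r⁻¹ := by
    rw [abs_of_nonneg (by linarith), ← div_eq_mul_inv, le_div_iff₀ hr0]
    nlinarith
  have e : heightMoment p n 1 - (I * r + (p:ℝ) - 3/2) =
      (heightMoment p n 1 - (I * s + (p:ℝ) - 3/2)) + I * (s - r) := by ring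
  rw [e]
  calc _ ≤ |heightMoment p n 1 - (I * s + (p:ℝ) - 3/2)| + |I| * |s - r| := by
        rw [← abs_mul]; exact abs_add_le _ _
    _ ≤ D * s⁻¹ + |I| * (p * r⁻¹) := by gcongr
    _ ≤ D * r⁻¹ + |I| * (p * r⁻¹) := by gcongr
    _ = _ := by ring

/-- `E(H_{n,p}) = (∫_0^∞ κ_p(h) dh)·√n + p − 3/2 + O(n^{-1/2})` as `n → ∞`. -/
theorem stmt15 (p : ℕ) (hp : 0 < p) :
    ∃ C : ℝ, ∃ n0 : ℕ, ∀ n : ℕ, n0 ≤ n →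
      |heightMoment p n 1 -
          ((∫ h in Set.Ioi (0:ℝ), kappa p h) * Real.sqrt n + (p : ℝ) - 3/2)|
        ≤ C * (Real.sqrt n)⁻¹ := by
  exact final15 p hp
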